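/- arXiv:math/0703898 — 2 statements merged into one kernel-verified Lean document; each statement's English description precedes it below -/
import Mathlib

section
/- Fix an integer t ≥ 0 and let Σ be the set of all patterns of the form 12^{p+1}12^q32^r together with all patterns of the form 12^{p+1}32^q12^r, where p, q, r range over nonnegative integers with p+q+r = t. Then all patterns in Σ are equivalent to each other, i.e., p(n;σ) = p(n;σ′) for all n and all σ, σ′ ∈ Σ. -/
/-- `π` is the canonical sequence of a set partition: every entry is at least 1,
and each entry is at most one more than the maximum of the preceding entries
(so the first entry is 1). -/
def IsCanonicalSeq (π : List ℕ) : Prop :=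
  ∀ i (h : i < π.length), 1 ≤ π.get ⟨i, h⟩ ∧ π.get ⟨i, h⟩ ≤ (π.take i).foldr max 0 + 1

/-- `π` contains the pattern `σ`: there is a subsequence of `π`
order-isomorphic to `σ`. -/
def ContainsPat (π σ : List ℕ) : Prop :=
  ∃ f : Fin σ.length → Fin π.length, StrictMono f ∧
    ∀ i j : Fin σ.length, σ.get i < σ.get j ↔ π.get (f i) < π.get (f j)

/-- `π` avoids the pattern `σ`. -/
def AvoidsPat (π σ : List ℕ) : Prop := ¬ ContainsPat π σ

/-- `pAvoid n σ` is the number of canonical sequences of partitions of `[n]`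
avoiding the pattern `σ`. -/
noncomputable def pAvoid (n : ℕ) (σ : List ℕ) : ℕ :=
  Set.ncard {π : List ℕ | π.length = n ∧ IsCanonicalSeq π ∧ AvoidsPat π σ}

/-- Two patterns are equivalent if they have the same number of avoiders of
each size. -/
def PatEquiv (σ σ' : List ℕ) : Prop := ∀ n, pAvoid n σ = pAvoid n σ'

/-- The increasing sequence `1, 2, …, k`. -/
def iota (k : ℕ) : List ℕ := (List.range k).map (· + 1)

/-- The set Σ of patterns 12^(p+1)12^q32^r and 12^(p+1)32^q12^r with
p + q + r = t. -/
def SigmaSet (t : ℕ) : Set (List ℕ) :=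
  {σ | ∃ p q r : ℕ, p + q + r = t ∧
    (σ = 1 :: List.replicate (p + 1) 2 ++ 1 :: List.replicate q 2 ++
           3 :: List.replicate r 2 ∨
     σ = 1 :: List.replicate (p + 1) 2 ++ 3 :: List.replicate q 2 ++
           1 :: List.replicate r 2)}

theorem cons_sublist_append_iff {α : Type*} {c : α} {t L₁ L : List α} (h : c ∉ L₁) :
    (c :: t).Sublist (L₁ ++ L) ↔ (c :: t).Sublist L := by
  induction L₁ with
  | nil => rfl
  | cons a L₁ ih =>
    simp only [List.mem_cons, not_or] at h
    rw [List.cons_append, List.sublist_cons_iff, ih h.2]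
    simp only [List.cons.injEq, or_iff_left_iff_imp, forall_exists_index, and_imp]
    intro r hr
    exact absurd hr h.1

theorem cons_sublist_append_cons_iff {α : Type*} {c : α} {t L₁ L : List α} (h : c ∉ L₁) :
    (c :: t).Sublist (L₁ ++ c :: L) ↔ t.Sublist L := by
  rw [cons_sublist_append_iff h, List.cons_sublist_cons]

/-- The flat word of a list of gaps: each gap is preceded by a marker. -/
def toFlat (g : List (List Bool)) : List (Option Bool) :=
  g.flatMap fun G => none :: G.map some

theorem toFlat_cons (G : List Bool) (g : List (List Bool)) :
    toFlat (G :: g) = none :: (G.map some ++ toFlat g) := by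
  simp [toFlat]

theorem toFlat_append (g h : List (List Bool)) : toFlat (g ++ h) = toFlat g ++ toFlat h := by
  simp [toFlat]

/-- The level pattern: `p + 1` markers, a letter `x`, `q` markers, the opposite letter,
`r` markers. -/
def levelPat (x : Bool) (p q r : ℕ) : List (Option Bool) :=
  List.replicate (p + 1) none ++ some x :: (List.replicate q none ++
    some (!x) :: List.replicate r none)

/-- The gap list avoids the level pattern. -/
def GapAvoids (x : Bool) (p q r : ℕ) (g : List (List Bool)) : Prop :=
  ¬ (levelPat x p q r).Sublist (toFlat g)

theorem none_notMem_map_some {α : Type*} (G : List α) : none ∉ G.map some := by simp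

theorem gapAvoids_succ (x : Bool) (p q r : ℕ) (g : List (List Bool)) :
    GapAvoids x (p + 1) q r g ↔ GapAvoids x p q r g.tail := by
  unfold GapAvoids
  rw [not_iff_not]
  cases g with
  | nil => simp [toFlat, levelPat]
  | cons G g =>
    have h : levelPat x (p + 1) q r = none :: levelPat x p q r := by
      simp [levelPat, List.replicate_succ]
    rw [toFlat_cons, h, List.cons_sublist_cons, List.tail_cons]
    have h : levelPat x p q r = none :: (List.replicate p none ++ some x ::
      (List.replicate q none ++ some (!x) :: List.replicate r none)) := by
      simp [levelPat, List.replicate_succ]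
    rw [h, cons_sublist_append_iff (none_notMem_map_some G)]

theorem gapAvoids_append_singleton (x : Bool) (p q r : ℕ) (g : List (List Bool)) (G : List Bool) :
    GapAvoids x p q (r + 1) (g ++ [G]) ↔ GapAvoids x p q r g := by
  unfold GapAvoids
  rw [not_iff_not]
  have h : levelPat x p q (r + 1) = levelPat x p q r ++ [none] := by
    simp [levelPat, List.replicate_succ']
  rw [h, toFlat_append, toFlat_cons, ← List.reverse_sublist]
  simp only [toFlat, List.flatMap_nil, List.append_nil, List.reverse_append, List.reverse_cons,
    List.reverse_nil, List.nil_append, List.append_assoc, List.singleton_append]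
  rw [cons_sublist_append_cons_iff (by simp), List.reverse_sublist]

/-- The core of the level pattern. -/
def corePat (x : Bool) (q : ℕ) : List (Option Bool) :=
  some x :: (List.replicate q none ++ [some (!x)])

/-- The gap list avoids the core of the level pattern. -/
def CoreAvoids (x : Bool) (q : ℕ) (g : List (List Bool)) : Prop :=
  ¬ (corePat x q).Sublist (toFlat g)

theorem gapAvoids_zero (x : Bool) (q : ℕ) (g : List (List Bool)) :
    GapAvoids x 0 q 0 g ↔ CoreAvoids x q g := by
  unfold GapAvoids CoreAvoids
  rw [not_iff_not]
  cases g with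
  | nil => simp [toFlat, levelPat, corePat]
  | cons G g =>
    have h : levelPat x 0 q 0 = none :: corePat x q := by
      simp [levelPat, corePat]
    rw [toFlat_cons, h, List.cons_sublist_cons, corePat,
      ← cons_sublist_append_iff (L₁ := [none]) (by simp)]
    rfl

theorem coreAvoids_nil (x : Bool) (q : ℕ) : CoreAvoids x q [] := by
  simp [CoreAvoids, toFlat, corePat]

theorem coreAvoids_cons_of_notMem {x : Bool} (q : ℕ) {G : List Bool} (hx : x ∉ G)
    (g : List (List Bool)) : CoreAvoids x q (G :: g) ↔ CoreAvoids x q g := by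
  unfold CoreAvoids
  rw [toFlat_cons, corePat, ← List.cons_append (a := none),
    cons_sublist_append_iff (by simpa using hx)]

theorem coreAvoids_cons_of_first {x : Bool} (q : ℕ) {G₁ G₂ : List Bool} (hx : x ∉ G₁)
    (g : List (List Bool)) : CoreAvoids x q ((G₁ ++ x :: G₂) :: g) ↔
      ¬ (List.replicate q none ++ [some (!x)]).Sublist (G₂.map some ++ toFlat g) := by
  unfold CoreAvoids
  rw [toFlat_cons, corePat, List.map_append, List.map_cons, List.append_assoc, List.cons_append,
    ← List.cons_append (a := none), cons_sublist_append_cons_iff (by simpa using hx)]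

theorem coreAvoids_succ_cons_of_mem {x : Bool} (q : ℕ) {G : List Bool} (hx : x ∈ G)
    (g : List (List Bool)) : CoreAvoids x (q + 1) (G :: g) ↔
      ¬ (List.replicate (q + 1) none ++ [some (!x)]).Sublist (toFlat g) := by
  obtain ⟨G₁, G₂, rfl, h⟩ := List.eq_append_cons_of_mem hx
  rw [coreAvoids_cons_of_first _ h, List.replicate_succ, List.cons_append,
    cons_sublist_append_iff (by simp)]

/-- No gap has two equal adjacent letters. -/
def GapsAlternate (g : List (List Bool)) : Prop := ∀ G ∈ g, G.IsChain (· ≠ ·)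

/-- The two gap lists have the same number of gaps and of letters of each kind. -/
def SameStat (g h : List (List Bool)) : Prop :=
  g.length = h.length ∧ ∀ b, g.flatten.count b = h.flatten.count b

/-- `f` maps alternating gap lists satisfying `Q` to alternating ones satisfying `Q'`
with the same statistics, and `f'` undoes this. -/
def StatMap (Q Q' : List (List Bool) → Prop) (f f' : List (List Bool) → List (List Bool)) :
    Prop :=
  ∀ g, GapsAlternate g → Q g →
    GapsAlternate (f g) ∧ SameStat (f g) g ∧ Q' (f g) ∧ f' (f g) = g

/-- There is a bijection preserving statistics between the alternating gap lists satisfying `Q`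
and those satisfying `Q'`. -/
def StatEquiv (Q Q' : List (List Bool) → Prop) : Prop :=
  ∃ f f', StatMap Q Q' f f' ∧ StatMap Q' Q f' f

theorem StatEquiv.refl (Q : List (List Bool) → Prop) : StatEquiv Q Q :=
  ⟨id, id, fun _ h h' => ⟨h, ⟨rfl, fun _ => rfl⟩, h', rfl⟩,
    fun _ h h' => ⟨h, ⟨rfl, fun _ => rfl⟩, h', rfl⟩⟩

theorem StatEquiv.symm {Q Q' : List (List Bool) → Prop} (h : StatEquiv Q Q') :
    StatEquiv Q' Q := by
  obtain ⟨f, f', h, h'⟩ := h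
  exact ⟨f', f, h', h⟩

theorem StatMap.comp {Q Q' R : List (List Bool) → Prop}
    {f f' e e' : List (List Bool) → List (List Bool)} (h : StatMap Q Q' f f')
    (h' : StatMap Q' R e e') : StatMap Q R (e ∘ f) (f' ∘ e') := by
  intro g hg hQ
  obtain ⟨h1, h2, h3, h4⟩ := h g hg hQ
  obtain ⟨k1, k2, k3, k4⟩ := h' _ h1 h3
  exact ⟨k1, ⟨k2.1.trans h2.1, fun b => (k2.2 b).trans (h2.2 b)⟩, k3, by simp [k4, h4]⟩

theorem StatEquiv.trans {Q Q' R : List (List Bool) → Prop} (h : StatEquiv Q Q')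
    (h' : StatEquiv Q' R) : StatEquiv Q R := by
  obtain ⟨f₁, f₂, hf₁, hf₂⟩ := h
  obtain ⟨e₁, e₂, he₁, he₂⟩ := h'
  exact ⟨e₁ ∘ f₁, f₂ ∘ e₂, hf₁.comp he₁, he₂.comp hf₂⟩

/-- Apply a map to the tail of a list. -/
def onTail {α : Type*} (f : List α → List α) : List α → List α
  | [] => []
  | a :: l => a :: f l

theorem StatMap.onTail {Q Q' : List (List Bool) → Prop}
    {f f' : List (List Bool) → List (List Bool)} (h : StatMap Q Q' f f') (hn : Q [] → Q' []) :
    StatMap (fun g => Q g.tail) (fun g => Q' g.tail) (onTail f) (onTail f') := by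
  intro g hg hQ
  cases g with
  | nil => exact ⟨hg, ⟨rfl, fun _ => rfl⟩, hn hQ, rfl⟩
  | cons G g =>
    obtain ⟨h1, h2, h3, h4⟩ := h g (fun G hG => hg G (List.mem_cons_of_mem _ hG)) hQ
    refine ⟨?_, ⟨by simp [_root_.onTail, h2.1], fun b => by simp [_root_.onTail, h2.2 b]⟩, h3,
      by simp [_root_.onTail, h4]⟩
    intro G' hG'
    rcases List.mem_cons.1 hG' with rfl | hG'
    · exact hg _ (List.mem_cons_self ..)
    · exact h1 _ hG'

theorem StatEquiv.tail {Q Q' : List (List Bool) → Prop} (h : StatEquiv Q Q') (hn : Q [] ↔ Q' []) :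
    StatEquiv (fun g => Q g.tail) (fun g => Q' g.tail) := by
  obtain ⟨f, f', hf, hf'⟩ := h
  exact ⟨_, _, hf.onTail hn.1, hf'.onTail hn.2⟩

theorem gapAvoids_nil (x : Bool) (p q r : ℕ) : GapAvoids x p q r [] := by
  simp [GapAvoids, toFlat, levelPat]

theorem StatEquiv.gapAvoids_add {x x' : Bool} {p q r p' q' r' : ℕ}
    (h : StatEquiv (GapAvoids x p q r) (GapAvoids x' p' q' r')) (s : ℕ) :
    StatEquiv (GapAvoids x (p + s) q r) (GapAvoids x' (p' + s) q' r') := by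
  induction s with
  | zero => exact h
  | succ s ih =>
    have := ih.tail (by simp [gapAvoids_nil])
    simp only [← gapAvoids_succ] at this
    exact this

theorem statEquiv_rotate (x : Bool) (p q r : ℕ) :
    StatEquiv (GapAvoids x (p + 1) q r) (GapAvoids x p q (r + 1)) := by
  refine ⟨fun g => g.rotate 1, fun g => g.rotate (g.length - 1), ?_, ?_⟩
  · intro g hg hQ
    refine ⟨fun G hG => hg G (by simpa using hG), ⟨by simp, fun b => ?_⟩, ?_, ?_⟩
    · exact ((List.rotate_perm g 1).flatten).count_eq b
    · cases g with
      | nil => exact gapAvoids_nil _ _ _ _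
      | cons G g =>
        simp only [List.rotate_cons_succ, List.rotate_zero]
        rw [gapAvoids_append_singleton]
        rwa [gapAvoids_succ] at hQ
    · cases g with
      | nil => rfl
      | cons G g =>
        simp only [List.rotate_rotate, List.length_rotate]
        simp [add_comm]
  · intro g hg hQ
    refine ⟨fun G hG => hg G (by simpa using hG), ⟨by simp, fun b => ?_⟩, ?_, ?_⟩
    · exact ((List.rotate_perm g _).flatten).count_eq b
    · rcases List.eq_nil_or_concat g with rfl | ⟨g, G, rfl⟩
      · exact gapAvoids_nil _ _ _ _
      · have : (g ++ [G]).rotate ((g ++ [G]).length - 1) = G :: g := by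
          simp [List.rotate_append_length_eq]
        simp only [List.concat_eq_append] at hQ ⊢
        rw [this, gapAvoids_succ]
        exact (gapAvoids_append_singleton _ _ _ _ _ _).1 hQ
    · cases g with
      | nil => rfl
      | cons G g =>
        simp only [List.rotate_rotate]
        simp

theorem toFlat_reverse (g : List (List Bool)) :
    toFlat (g.map List.reverse).reverse ++ [none] = none :: (toFlat g).reverse := by
  induction g with
  | nil => rfl
  | cons G g ih =>
    rw [List.map_cons, List.reverse_cons, toFlat_append, toFlat_cons, toFlat_cons]
    simp only [List.reverse_cons, List.reverse_append, ← List.cons_append, ← ih]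
    simp [toFlat]

theorem coreAvoids_reverse (x : Bool) (g : List (List Bool)) :
    CoreAvoids (!x) 0 (g.map List.reverse).reverse ↔ CoreAvoids x 0 g := by
  unfold CoreAvoids
  rw [not_iff_not]
  have h1 : (corePat x 0).Sublist (toFlat g) ↔
      (corePat (!x) 0).Sublist (none :: (toFlat g).reverse) := by
    rw [← List.reverse_sublist]
    simp only [corePat, List.replicate_zero, List.nil_append, List.reverse_cons, List.reverse_nil,
      List.singleton_append, Bool.not_not]
    rw [← cons_sublist_append_iff (L₁ := [none]) (by simp)]
    rfl
  rw [h1, ← toFlat_reverse, ← List.reverse_sublist, ← List.reverse_sublist (l₂ := _ ++ _)]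
  simp only [corePat, List.replicate_zero, List.nil_append, List.reverse_cons, List.reverse_nil,
      List.singleton_append, Bool.not_not, List.reverse_append]
  exact (cons_sublist_append_iff (L₁ := [none]) (by simp)).symm

theorem statMap_reverse (x : Bool) :
    StatMap (GapAvoids x 0 0 0) (GapAvoids (!x) 0 0 0)
      (fun g => (g.map List.reverse).reverse) (fun g => (g.map List.reverse).reverse) := by
  intro g hg hQ
  refine ⟨?_, ⟨by simp, fun b => ?_⟩, ?_, ?_⟩
  · intro G hG
    simp only [List.mem_reverse, List.mem_map] at hG
    obtain ⟨G, hG, rfl⟩ := hG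
    rw [List.isChain_reverse]
    exact (hg G hG).imp fun _ _ h => h.symm
  · rw [← List.reverse_flatten, List.count_reverse]
  · rw [gapAvoids_zero] at hQ ⊢
    rwa [coreAvoids_reverse]
  · simp

theorem statEquiv_not (x : Bool) (p : ℕ) :
    StatEquiv (GapAvoids x p 0 0) (GapAvoids (!x) p 0 0) := by
  have h : StatEquiv (GapAvoids x 0 0 0) (GapAvoids (!x) 0 0 0) :=
    ⟨_, _, statMap_reverse x, by simpa using statMap_reverse (!x)⟩
  simpa using h.gapAvoids_add p

/-- Insert `F` after the first gap containing `x`. -/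
def insertGap (x : Bool) (F : List Bool) : List (List Bool) → List (List Bool)
  | [] => [F]
  | G :: g => if x ∈ G then G :: F :: g else G :: insertGap x F g

/-- Insert the first gap after the first later gap containing `x`. -/
def insertHead (x : Bool) : List (List Bool) → List (List Bool)
  | [] => []
  | F :: g => insertGap x F g

/-- Exchange the first two gaps. -/
def swapHead : List (List Bool) → List (List Bool)
  | F :: G :: g => G :: F :: g
  | g => g

/-- Move the gap following the first gap containing `x` to the front. -/
def extractGap (x : Bool) : List (List Bool) → List (List Bool)
  | [] => []
  | [G] => [G]
  | G :: D :: g => if x ∈ G then D :: G :: g else swapHead (G :: extractGap x (D :: g))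

theorem insertGap_perm (x : Bool) (F : List Bool) (g : List (List Bool)) :
    (insertGap x F g).Perm (F :: g) := by
  induction g with
  | nil => rfl
  | cons G g ih =>
    unfold insertGap
    split_ifs
    · exact List.Perm.swap ..
    · exact (ih.cons G).trans (List.Perm.swap ..)

theorem swapHead_perm (g : List (List Bool)) : (swapHead g).Perm g := by
  unfold swapHead
  split
  · exact List.Perm.swap ..
  · rfl

theorem extractGap_perm (x : Bool) (g : List (List Bool)) : (extractGap x g).Perm g := by
  induction g with
  | nil => rfl
  | cons G g ih =>
    cases g with
    | nil => rfl
    | cons D g =>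
      unfold extractGap
      split_ifs
      · exact List.Perm.swap ..
      · exact (swapHead_perm _).trans (ih.cons G)

theorem SameStat.of_perm {g h : List (List Bool)} (p : g.Perm h) : SameStat g h :=
  ⟨p.length_eq, fun b => p.flatten.count_eq b⟩

theorem GapsAlternate.of_perm {g h : List (List Bool)} (p : g.Perm h) (hh : GapsAlternate h) :
    GapsAlternate g :=
  fun G hG => hh G (p.mem_iff.1 hG)

theorem insertGap_ne_nil (x : Bool) (F : List Bool) (g : List (List Bool)) :
    insertGap x F g ≠ [] := by
  cases g <;> unfold insertGap <;> [simp; (split_ifs <;> simp)]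

theorem extractGap_insertGap (x : Bool) (F : List Bool) (g : List (List Bool)) :
    extractGap x (insertGap x F g) = F :: g := by
  induction g with
  | nil => rfl
  | cons G g ih =>
    unfold insertGap
    split_ifs with h
    · simp [extractGap, h]
    · obtain ⟨D, l, hl⟩ := List.exists_cons_of_ne_nil (insertGap_ne_nil x F g)
      rw [hl] at ih ⊢
      simp [extractGap, h, ih, swapHead]

theorem insertHead_extractGap (x : Bool) (g : List (List Bool)) :
    insertHead x (extractGap x g) = g := by
  induction g with
  | nil => rfl
  | cons G g ih =>
    cases g with
    | nil => rfl
    | cons D g =>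
      unfold extractGap
      split_ifs with h
      · simp [insertHead, insertGap, h]
      · have := (extractGap_perm x (D :: g)).length_eq
        obtain ⟨F, l, hl⟩ := List.exists_cons_of_ne_nil
          (List.ne_nil_of_length_eq_add_one (this.trans (List.length_cons ..)))
        rw [hl] at ih ⊢
        simp only [insertHead] at ih
        simp [swapHead, insertHead, insertGap, h, ih]

theorem coreAvoids_succ_singleton (x : Bool) (q : ℕ) (F : List Bool) :
    CoreAvoids x (q + 1) [F] := by
  by_cases h : x ∈ F
  · simp [coreAvoids_succ_cons_of_mem _ h, toFlat]
  · simp [coreAvoids_cons_of_notMem _ h, coreAvoids_nil]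

theorem coreAvoids_insertGap (x : Bool) (q : ℕ) (F : List Bool) (g : List (List Bool)) :
    CoreAvoids x (q + 2) (insertGap x F g) ↔ CoreAvoids x (q + 1) g := by
  induction g with
  | nil =>
    exact iff_of_true (coreAvoids_succ_singleton _ _ _) (coreAvoids_nil _ _)
  | cons G g ih =>
    unfold insertGap
    split_ifs with h
    · rw [coreAvoids_succ_cons_of_mem _ h, coreAvoids_succ_cons_of_mem _ h, toFlat_cons,
        List.replicate_succ, List.cons_append, List.cons_sublist_cons, List.replicate_succ,
        List.cons_append, cons_sublist_append_iff (none_notMem_map_some F)]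
    · rw [coreAvoids_cons_of_notMem _ h, coreAvoids_cons_of_notMem _ h, ih]

theorem statEquiv_core_succ (x : Bool) (q : ℕ) :
    StatEquiv (fun g => CoreAvoids x (q + 1) g.tail) (CoreAvoids x (q + 2)) := by
  refine ⟨insertHead x, extractGap x, ?_, ?_⟩
  · intro g hg hQ
    cases g with
    | nil => exact ⟨hg, .of_perm (.refl _), coreAvoids_nil _ _, rfl⟩
    | cons F g =>
      exact ⟨hg.of_perm (insertGap_perm ..), .of_perm (insertGap_perm ..),
        (coreAvoids_insertGap ..).2 hQ, extractGap_insertGap ..⟩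
  · intro g hg hQ
    refine ⟨hg.of_perm (extractGap_perm ..), .of_perm (extractGap_perm ..), ?_,
      insertHead_extractGap ..⟩
    rw [← insertHead_extractGap x g] at hQ
    cases h : extractGap x g with
    | nil => exact coreAvoids_nil _ _
    | cons F l =>
      rw [h] at hQ
      exact (coreAvoids_insertGap ..).1 hQ

/-- Insert `F` after the first gap containing `x`, exchanging the ends of the two gaps. -/
def mergeGap (x : Bool) (F : List Bool) : List (List Bool) → List (List Bool)
  | [] => [F]
  | G :: g =>
    if x ∈ G then
      if F.head? = some x then (G ++ F.tail) :: [x] :: g else (G ++ F) :: [] :: g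
    else G :: mergeGap x F g

/-- Insert the first gap by `mergeGap`. -/
def mergeHead (x : Bool) : List (List Bool) → List (List Bool)
  | [] => []
  | F :: g => mergeGap x F g

/-- The inverse of `mergeHead`. -/
def unmergeGap (x : Bool) : List (List Bool) → List (List Bool)
  | [] => []
  | [G] => [G]
  | G :: D :: g =>
    if x ∈ G then
      (D ++ (G.dropWhile (· != x)).tail) :: (G.takeWhile (· != x) ++ [x]) :: g
    else swapHead (G :: unmergeGap x (D :: g))

theorem SameStat.trans {g h k : List (List Bool)} (h₁ : SameStat g h) (h₂ : SameStat h k) :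
    SameStat g k :=
  ⟨h₁.1.trans h₂.1, fun b => (h₁.2 b).trans (h₂.2 b)⟩

theorem SameStat.cons {g h : List (List Bool)} (hs : SameStat g h) (G : List Bool) :
    SameStat (G :: g) (G :: h) :=
  ⟨by simp [hs.1], fun b => by simp [hs.2 b]⟩

theorem gapsAlternate_cons {G : List Bool} {g : List (List Bool)} :
    GapsAlternate (G :: g) ↔ G.IsChain (· ≠ ·) ∧ GapsAlternate g := by
  simp [GapsAlternate]

theorem dropWhile_first {x : Bool} {G₁ : List Bool} (G₂ : List Bool) (h : x ∉ G₁) :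
    (G₁ ++ x :: G₂).dropWhile (· != x) = x :: G₂ := by
  induction G₁ with
  | nil => simp
  | cons a G₁ ih =>
    simp only [List.mem_cons, not_or] at h
    simp [ih h.2, Ne.symm h.1]

theorem takeWhile_first {x : Bool} {G₁ : List Bool} (G₂ : List Bool) (h : x ∉ G₁) :
    (G₁ ++ x :: G₂).takeWhile (· != x) = G₁ := by
  induction G₁ with
  | nil => simp
  | cons a G₁ ih =>
    simp only [List.mem_cons, not_or] at h
    simp [ih h.2, Ne.symm h.1]

theorem eq_nil_of_isChain_cons {x : Bool} {G : List Bool} (h : (x :: G).IsChain (· ≠ ·))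
    (hx : (!x) ∉ G) : G = [] := by
  cases G with
  | nil => rfl
  | cons y G =>
    rw [List.isChain_cons_cons] at h
    cases x <;> cases y <;> simp_all

/-- With `q = 0` the gap containing the first `x` ends there. -/
theorem eq_append_of_coreAvoids_zero {x : Bool} {G : List Bool} {g : List (List Bool)}
    (hx : x ∈ G) (hG : G.IsChain (· ≠ ·)) (hc : CoreAvoids x 0 (G :: g)) :
    ∃ G₁, x ∉ G₁ ∧ G = G₁ ++ [x] := by
  obtain ⟨G₁, G₂, rfl, h⟩ := List.eq_append_cons_of_mem hx
  rw [coreAvoids_cons_of_first _ h] at hc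
  have : (!x) ∉ G₂ := by
    intro h'
    apply hc
    simp [h']
  have h2 := eq_nil_of_isChain_cons hG.right_of_append this
  exact ⟨G₁, h, by rw [h2]⟩

theorem mergeGap_ne_nil (x : Bool) (F : List Bool) (g : List (List Bool)) :
    mergeGap x F g ≠ [] := by
  cases g <;> unfold mergeGap <;> [simp; (split_ifs <;> simp)]

theorem mergeGap_spec (x : Bool) (F : List Bool) (hF : F.IsChain (· ≠ ·))
    (g : List (List Bool)) (hg : GapsAlternate g) (hc : CoreAvoids x 0 g) :
    GapsAlternate (mergeGap x F g) ∧ SameStat (mergeGap x F g) (F :: g) ∧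
      CoreAvoids x 1 (mergeGap x F g) ∧ unmergeGap x (mergeGap x F g) = F :: g := by
  induction g with
  | nil =>
    refine ⟨by simpa [mergeGap, GapsAlternate] using hF, .of_perm (.refl _),
      coreAvoids_succ_singleton _ _ _, rfl⟩
  | cons G g ih =>
    rw [gapsAlternate_cons] at hg
    unfold mergeGap
    split_ifs with h hh
    · obtain ⟨F, rfl⟩ : ∃ F', F = x :: F' := by
        cases F <;> simp_all
      obtain ⟨G, h1, rfl⟩ := eq_append_of_coreAvoids_zero h hg.1 hc
      rw [coreAvoids_cons_of_first _ h1] at hc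
      refine ⟨?_, ?_, ?_, ?_⟩
      · rw [gapsAlternate_cons, gapsAlternate_cons]
        refine ⟨?_, by simp, hg.2⟩
        have := hg.1
        simp only [List.tail_cons, List.append_assoc, List.singleton_append]
        exact List.isChain_split.2 ⟨this, hF⟩
      · refine ⟨rfl, fun b => ?_⟩
        simp [List.count_cons]
        omega
      · rw [List.append_assoc, List.singleton_append, coreAvoids_cons_of_first _ h1]
        simp only [toFlat_cons, List.replicate_one, List.singleton_append]
        rw [cons_sublist_append_cons_iff (none_notMem_map_some _)]
        simpa using hc
      · simp [unmergeGap, dropWhile_first _ h1, takeWhile_first _ h1]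
    · obtain ⟨G, h1, rfl⟩ := eq_append_of_coreAvoids_zero h hg.1 hc
      rw [coreAvoids_cons_of_first _ h1] at hc
      refine ⟨?_, ?_, ?_, ?_⟩
      · rw [gapsAlternate_cons, gapsAlternate_cons]
        refine ⟨?_, by simp, hg.2⟩
        refine hg.1.append hF ?_
        intro y hy z hz
        simp at hy
        subst hy
        rintro rfl
        exact hh hz
      · refine ⟨rfl, fun b => ?_⟩
        simp [List.count_cons]
        omega
      · rw [List.append_assoc, List.singleton_append, coreAvoids_cons_of_first _ h1]
        simp only [toFlat_cons, List.replicate_one, List.singleton_append]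
        rw [cons_sublist_append_cons_iff (none_notMem_map_some _)]
        simpa using hc
      · simp [unmergeGap, dropWhile_first _ h1, takeWhile_first _ h1]
    · rw [coreAvoids_cons_of_notMem _ h] at hc
      obtain ⟨h1, h2, h3, h4⟩ := ih hg.2 hc
      refine ⟨gapsAlternate_cons.2 ⟨hg.1, h1⟩, (h2.cons G).trans (.of_perm (.swap ..)),
        (coreAvoids_cons_of_notMem _ h _).2 h3, ?_⟩
      obtain ⟨D, l, hl⟩ := List.exists_cons_of_ne_nil (mergeGap_ne_nil x F g)
      rw [hl] at h4 ⊢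
      simp [unmergeGap, h, h4, swapHead]

theorem unmergeGap_spec (x : Bool) (g : List (List Bool)) (hg : GapsAlternate g)
    (hc : CoreAvoids x 1 g) :
    GapsAlternate (unmergeGap x g) ∧ SameStat (unmergeGap x g) g ∧
      CoreAvoids x 0 (unmergeGap x g).tail ∧ mergeHead x (unmergeGap x g) = g := by
  induction g with
  | nil => exact ⟨hg, .of_perm (.refl _), coreAvoids_nil _ _, rfl⟩
  | cons G g ih =>
    cases g with
    | nil => exact ⟨hg, .of_perm (.refl _), coreAvoids_nil _ _, rfl⟩
    | cons D g =>
      rw [gapsAlternate_cons] at hg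
      unfold unmergeGap
      split_ifs with h
      · obtain ⟨G₁, G₂, rfl, h1⟩ := List.eq_append_cons_of_mem h
        rw [coreAvoids_cons_of_first _ h1] at hc
        rw [gapsAlternate_cons] at hg
        rw [dropWhile_first _ h1, takeWhile_first _ h1, List.tail_cons]
        simp only [toFlat_cons, List.replicate_one, List.singleton_append] at hc
        rw [cons_sublist_append_cons_iff (none_notMem_map_some _)] at hc
        simp only [List.singleton_sublist, List.mem_append, List.mem_map, Option.some.injEq,
          exists_eq_right, not_or] at hc
        have hG2 := List.isChain_split.1 hg.1
        have hD : D = [] ∨ D = [x] := by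
          cases D with
          | nil => simp
          | cons y D =>
            have : y = x := by
              cases x <;> cases y <;> simp_all
            subst this
            exact Or.inr (by rw [eq_nil_of_isChain_cons hg.2.1 (by simp_all)])
        have hhead : G₂.head? ≠ some x := by
          rintro h
          cases G₂ with
          | nil => simp at h
          | cons y G₂ =>
            simp at h
            subst h
            simp at hG2
        refine ⟨?_, ?_, ?_, ?_⟩
        · rw [gapsAlternate_cons, gapsAlternate_cons]
          refine ⟨?_, hG2.1, hg.2.2⟩
          rcases hD with rfl | rfl
          · exact hG2.2.tail
          · exact hG2.2
        · refine ⟨rfl, fun b => ?_⟩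
          simp [List.count_cons]
          omega
        · rw [List.tail_cons, coreAvoids_cons_of_first _ h1]
          simpa using hc.2
        · rcases hD with rfl | rfl
          · simp [mergeHead, mergeGap, hhead]
          · simp [mergeHead, mergeGap]
      · rw [coreAvoids_cons_of_notMem _ h] at hc
        obtain ⟨h1, h2, h3, h4⟩ := ih hg.2 hc
        obtain ⟨F, l, hl⟩ := List.exists_cons_of_ne_nil
          (List.ne_nil_of_length_eq_add_one (h2.1.trans (List.length_cons ..)))
        rw [hl] at h1 h2 h3 h4 ⊢
        have hp : (swapHead (G :: F :: l)).Perm (G :: F :: l) := swapHead_perm _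
        refine ⟨GapsAlternate.of_perm hp (gapsAlternate_cons.2 ⟨hg.1, h1⟩),
          (SameStat.of_perm hp).trans (h2.cons G), ?_, ?_⟩
        · exact (coreAvoids_cons_of_notMem _ h _).2 h3
        · simp only [mergeHead] at h4
          simp [swapHead, mergeHead, mergeGap, h, h4]

theorem statEquiv_core_zero (x : Bool) :
    StatEquiv (fun g => CoreAvoids x 0 g.tail) (CoreAvoids x 1) := by
  refine ⟨mergeHead x, unmergeGap x, ?_, fun g => unmergeGap_spec x g⟩
  intro g hg hQ
  cases g with
  | nil => exact ⟨hg, .of_perm (.refl _), coreAvoids_nil _ _, rfl⟩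
  | cons F g =>
    rw [gapsAlternate_cons] at hg
    exact mergeGap_spec x F hg.1 g hg.2 hQ

theorem statEquiv_core (x : Bool) (q : ℕ) :
    StatEquiv (fun g => CoreAvoids x q g.tail) (CoreAvoids x (q + 1)) := by
  cases q with
  | zero => exact statEquiv_core_zero x
  | succ q => exact statEquiv_core_succ x q

theorem statEquiv_slide (x : Bool) (p q : ℕ) :
    StatEquiv (GapAvoids x (p + 1) q 0) (GapAvoids x p (q + 1) 0) := by
  have h : StatEquiv (GapAvoids x 1 q 0) (GapAvoids x 0 (q + 1) 0) := by
    have := statEquiv_core x q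
    simp only [← gapAvoids_zero, ← gapAvoids_succ] at this
    simpa only [zero_add, ← funext fun g => propext (gapAvoids_zero x (q + 1) g)] using this
  have := h.gapAvoids_add p
  rwa [zero_add, add_comm] at this

theorem statEquiv_normal (x : Bool) (p q r : ℕ) :
    StatEquiv (GapAvoids x p q r) (GapAvoids x (p + q + r) 0 0) := by
  induction r generalizing p with
  | zero =>
    induction q generalizing p with
    | zero => exact .refl _
    | succ q ih =>
      have := ih (p + 1)
      rw [show p + 1 + q + 0 = p + (q + 1) + 0 by ring] at this
      exact (statEquiv_slide x p q).symm.trans this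
  | succ r ih =>
    have := ih (p + 1)
    rw [show p + 1 + q + r = p + q + (r + 1) by ring] at this
    exact (statEquiv_rotate x p q r).symm.trans this

theorem statEquiv_gapAvoids (x x' : Bool) {p q r p' q' r' : ℕ}
    (h : p + q + r = p' + q' + r') :
    StatEquiv (GapAvoids x p q r) (GapAvoids x' p' q' r') := by
  refine (statEquiv_normal x p q r).trans (.trans ?_ (statEquiv_normal x' p' q' r').symm)
  rw [h]
  rcases Bool.eq_or_eq_not x' x with rfl | rfl
  · exact .refl _
  · exact statEquiv_not ..

/-- The letter `a` is above `k` (for `b = true`) or below `k` (for `b = false`). -/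
def OnSide (k : ℕ) (b : Bool) (a : ℕ) : Prop := if b then k < a else a < k

instance (k : ℕ) (b : Bool) (a : ℕ) : Decidable (OnSide k b a) := by
  unfold OnSide; infer_instance

/-- The type of the letter `a` at level `k`. -/
def letterType (k a : ℕ) : Option Bool := if a = k then none else some (decide (k < a))

theorem letterType_of_onSide {k a : ℕ} {b : Bool} (h : OnSide k b a) :
    letterType k a = some b := by
  unfold OnSide at h
  unfold letterType
  cases b <;> simp_all <;> omega

theorem onSide_decide {k a : ℕ} (h : a ≠ k) : OnSide k (decide (k < a)) a := by
  unfold OnSide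
  by_cases h' : k < a <;> simp [h'] ; omega

theorem not_onSide_self (k : ℕ) (b : Bool) : ¬ OnSide k b k := by
  cases b <;> simp [OnSide]

theorem not_onSide_not {k a : ℕ} {b : Bool} (h : OnSide k b a) : ¬ OnSide k (!b) a := by
  cases b <;> simp [OnSide] at * <;> omega

/-- Replace in a word each letter `none` by `k` and each letter `some b` by the next
segment of the list `s b`. -/
def fill (k : ℕ) : List (Option Bool) → (Bool → List (List ℕ)) → List ℕ
  | [], _ => []
  | none :: w, s => k :: fill k w s
  | some b :: w, s => (s b).headD [] ++ fill k w (Function.update s b (s b).tail)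

/-- Cut a sequence into the letters `k` and maximal segments of letters above or below `k`. -/
def cut (k : ℕ) : List ℕ → List (Option Bool) × (Bool → List (List ℕ))
  | [] => ([], fun _ => [])
  | a :: l =>
    let c := cut k l
    if a = k then (none :: c.1, c.2) else
      let b := decide (k < a)
      if c.1.head? = some (some b) then
        (c.1, Function.update c.2 b ((a :: (c.2 b).headD []) :: (c.2 b).tail))
      else (some b :: c.1, Function.update c.2 b ([a] :: c.2 b))

/-- No two equal adjacent letters other than `none`. -/
abbrev WordAlternates (w : List (Option Bool)) : Prop := w.IsChain fun u v => u = v → u = none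

/-- The segments `s` are nonempty, consist of letters on the appropriate side of `k`,
and there are as many as the letters of `w` require. -/
def Fits (k : ℕ) (w : List (Option Bool)) (s : Bool → List (List ℕ)) : Prop :=
  ∀ b, w.count (some b) = (s b).length ∧ ∀ u ∈ s b, u ≠ [] ∧ ∀ a ∈ u, OnSide k b a

theorem Fits.nil {k : ℕ} {s : Bool → List (List ℕ)} (h : Fits k [] s) : s = fun _ => [] := by
  funext b
  simpa [eq_comm] using (h b).1

theorem fits_none_cons {k : ℕ} {w : List (Option Bool)} {s : Bool → List (List ℕ)} :
    Fits k (none :: w) s ↔ Fits k w s := by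
  simp [Fits]

theorem Fits.cons {k : ℕ} {w : List (Option Bool)} {s : Bool → List (List ℕ)} (h : Fits k w s)
    {b : Bool} {u : List ℕ} (hu : u ≠ []) (hub : ∀ a ∈ u, OnSide k b a) :
    Fits k (some b :: w) (Function.update s b (u :: s b)) := by
  intro b'
  obtain ⟨h1, h2⟩ := h b'
  by_cases hb : b' = b
  · subst hb
    simp only [List.count_cons_self, Function.update_self, List.length_cons, h1, List.mem_cons,
      true_and]
    rintro v (rfl | hv)
    · exact ⟨hu, hub⟩
    · exact h2 v hv
  · rw [Function.update_of_ne hb, List.count_cons_of_ne (by simpa using Ne.symm hb)]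
    exact ⟨h1, h2⟩

/-- Destructing the first segment. -/
theorem Fits.exists_of_some_cons {k : ℕ} {b : Bool} {w : List (Option Bool)}
    {s : Bool → List (List ℕ)} (h : Fits k (some b :: w) s) :
    ∃ u s', u ≠ [] ∧ (∀ a ∈ u, OnSide k b a) ∧ Fits k w s' ∧
      s = Function.update s' b (u :: s' b) := by
  obtain ⟨h1, h2⟩ := h b
  obtain ⟨u, us, hs⟩ : ∃ u us, s b = u :: us := by
    cases hs : s b with
    | nil => simp [hs] at h1
    | cons u us => exact ⟨u, us, rfl⟩
  rw [hs] at h1 h2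
  refine ⟨u, Function.update s b us, (h2 u (by simp)).1, (h2 u (by simp)).2, ?_, ?_⟩
  · intro b'
    by_cases hb : b' = b
    · subst hb
      rw [Function.update_self]
      exact ⟨by simpa using h1, fun v hv => h2 v (List.mem_cons_of_mem _ hv)⟩
    · rw [Function.update_of_ne hb]
      have := h b'
      rwa [List.count_cons_of_ne (by simpa using Ne.symm hb)] at this
  · simp [← hs]

theorem fill_some_cons (k : ℕ) (b : Bool) (w : List (Option Bool)) (s : Bool → List (List ℕ))
    (u : List ℕ) :
    fill k (some b :: w) (Function.update s b (u :: s b)) = u ++ fill k w s := by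
  simp [fill]

/-- An induction principle for words with fitting segments. -/
theorem Fits.rec' {k : ℕ} {motive : List (Option Bool) → (Bool → List (List ℕ)) → Prop}
    (nil : motive [] fun _ => [])
    (none : ∀ w s, Fits k w s → WordAlternates w → motive w s → motive (none :: w) s)
    (some : ∀ b w s u, Fits k w s → WordAlternates w → w.head? ≠ some (some b) → u ≠ [] →
      (∀ a ∈ u, OnSide k b a) → motive w s →
      motive (some b :: w) (Function.update s b (u :: s b)))
    {w : List (Option Bool)} {s : Bool → List (List ℕ)} (h : Fits k w s)
    (hw : WordAlternates w) : motive w s := by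
  induction w generalizing s with
  | nil => rw [h.nil]; exact nil
  | cons c w ih =>
    cases c with
    | none =>
      rw [fits_none_cons] at h
      exact none _ _ h hw.tail (ih h hw.tail)
    | some b =>
      obtain ⟨u, s', hu, hub, hs', rfl⟩ := h.exists_of_some_cons
      refine some _ _ _ _ hs' hw.tail ?_ hu hub (ih hs' hw.tail)
      intro hh
      cases w with
      | nil => simp at hh
      | cons c w =>
        simp at hh
        subst hh
        simp [WordAlternates] at hw

theorem cut_append {k : ℕ} {b : Bool} {u : List ℕ} (hu : u ≠ []) (hub : ∀ a ∈ u, OnSide k b a)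
    {l : List ℕ} {w : List (Option Bool)} {s : Bool → List (List ℕ)} (hl : cut k l = (w, s))
    (hw : w.head? ≠ some (some b)) :
    cut k (u ++ l) = (some b :: w, Function.update s b (u :: s b)) := by
  induction u with
  | nil => exact absurd rfl hu
  | cons a u ih =>
    have ha : OnSide k b a := hub a (by simp)
    have hne : a ≠ k := by rintro rfl; exact not_onSide_self _ _ ha
    have hd : decide (k < a) = b := by
      have := letterType_of_onSide ha
      simpa [letterType, hne] using this
    by_cases hu' : u = []
    · subst hu'
      simp [cut, hl, hne, hd, hw]
    · have := ih hu' fun a h => hub a (by simp [h])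
      rw [List.cons_append, cut, this]
      simp [hne, hd]

theorem cut_fill {k : ℕ} {w : List (Option Bool)} {s : Bool → List (List ℕ)} (h : Fits k w s)
    (hw : WordAlternates w) : cut k (fill k w s) = (w, s) := by
  refine Fits.rec' (k := k) (motive := fun w s => cut k (fill k w s) = (w, s)) ?_ ?_ ?_ h hw
  · rfl
  · intro w s _ _ ih
    simp [fill, cut, ih]
  · intro b w s u _ _ hb hu hub ih
    rw [fill_some_cons, cut_append hu hub ih hb]

theorem cut_spec (k : ℕ) (l : List ℕ) : Fits k (cut k l).1 (cut k l).2 ∧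
    WordAlternates (cut k l).1 ∧ fill k (cut k l).1 (cut k l).2 = l := by
  induction l with
  | nil => simp [cut, fill, Fits]
  | cons a l ih =>
    unfold cut
    generalize cut k l = c at ih
    obtain ⟨w, s⟩ := c
    obtain ⟨h1, h2, h3⟩ := ih
    simp only at h1 h2 h3 ⊢
    split_ifs with ha hb
    · refine ⟨fits_none_cons.2 h1, ?_, by simp [fill, h3, ha]⟩
      exact List.isChain_cons.2 ⟨by simp, h2⟩
    · have hsa := onSide_decide ha
      generalize decide (k < a) = b at hb hsa
      cases w with
      | nil => simp at hb
      | cons c w =>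
        simp at hb
        subst hb
        obtain ⟨u, s', hu, hub, hs', rfl⟩ := h1.exists_of_some_cons
        refine ⟨?_, h2, ?_⟩
        · simp only [Function.update_self, List.headD_cons, List.tail_cons, Function.update_idem]
          refine hs'.cons (by simp) ?_
          simpa [hsa] using hub
        · simp only [Function.update_self, List.headD_cons, List.tail_cons, Function.update_idem]
          rw [fill_some_cons] at h3 ⊢
          simp [h3]
    · have hsa := onSide_decide ha
      generalize decide (k < a) = b at hb hsa
      refine ⟨h1.cons (by simp) (by simpa using hsa), ?_, by simp [fill_some_cons, h3]⟩
      refine List.isChain_cons.2 ⟨?_, h2⟩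
      rintro y hy rfl
      exact absurd hy hb

theorem fill_perm {k : ℕ} {w : List (Option Bool)} {s : Bool → List (List ℕ)} (h : Fits k w s) :
    (fill k w s).Perm
      (List.replicate (w.count none) k ++ ((s true).flatten ++ (s false).flatten)) := by
  induction w generalizing s with
  | nil => simp [h.nil, fill]
  | cons c w ih =>
    cases c with
    | none =>
      rw [fits_none_cons] at h
      simpa [fill, List.replicate_succ] using ih h
    | some b =>
      obtain ⟨u, s', hu, hub, hs', rfl⟩ := h.exists_of_some_cons
      rw [fill_some_cons]
      refine ((ih hs').append_left u).trans ?_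
      rw [List.perm_iff_count]
      intro a
      cases b <;> simp [List.count_append] <;> omega

theorem filter_fill {k : ℕ} {w : List (Option Bool)} {s : Bool → List (List ℕ)}
    (h : Fits k w s) : (fill k w s).filter (k < ·) = (s true).flatten := by
  induction w generalizing s with
  | nil => simp [h.nil, fill]
  | cons c w ih =>
    cases c with
    | none =>
      rw [fits_none_cons] at h
      simpa [fill] using ih h
    | some b =>
      obtain ⟨u, s', hu, hub, hs', rfl⟩ := h.exists_of_some_cons
      rw [fill_some_cons, List.filter_append, ih hs']
      cases b
      · simp [OnSide] at hub ⊢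
        intro a ha
        exact (hub a ha).le
      · simp [OnSide] at hub ⊢
        exact hub

/-- A word without equal adjacent letters uses at most one letter of a constant block. -/
theorem sublist_replicate_append_iff {t : List (Option Bool)} (ht : WordAlternates t) (b : Bool)
    (n : ℕ) (l : List (Option Bool)) :
    t.Sublist (List.replicate (n + 1) (some b) ++ l) ↔ t.Sublist (some b :: l) := by
  induction n generalizing t with
  | zero => rfl
  | succ n ih =>
    refine ⟨fun h => ?_, fun h => h.trans ?_⟩
    · rw [List.replicate_succ, List.cons_append, List.sublist_cons_iff] at h
      rcases h with h | ⟨r, rfl, h⟩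
      · exact (ih ht).1 h
      · have hr : WordAlternates r := ht.tail
        rw [ih hr] at h
        rw [List.cons_sublist_cons]
        cases r with
        | nil => simp
        | cons c r =>
          have : some b ≠ c := by
            rintro rfl
            simp [WordAlternates] at ht
          rw [← List.singleton_append (l := l),
            cons_sublist_append_iff (by simpa using this.symm)] at h
          exact h
    · rw [List.replicate_succ, List.cons_append, List.cons_sublist_cons,
        List.replicate_succ']
      simp

theorem sublist_cons_congr {α : Type*} {P : List α → Prop} (hP : ∀ a t, P (a :: t) → P t)
    {l l' : List α} (h : ∀ t, P t → (t.Sublist l ↔ t.Sublist l')) (a : α) (t : List α)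
    (ht : P t) : t.Sublist (a :: l) ↔ t.Sublist (a :: l') := by
  rw [List.sublist_cons_iff, List.sublist_cons_iff, h t ht]
  refine or_congr_right (exists_congr fun r => and_congr_right fun hr => h r (hP a r ?_))
  rwa [← hr]

theorem sublist_map_fill_iff {k : ℕ} {w : List (Option Bool)} {s : Bool → List (List ℕ)}
    (h : Fits k w s) (t : List (Option Bool)) (ht : WordAlternates t) :
    t.Sublist ((fill k w s).map (letterType k)) ↔ t.Sublist w := by
  induction w generalizing s t with
  | nil => simp [fill]
  | cons c w ih =>
    cases c with
    | none =>
      rw [fits_none_cons] at h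
      have : letterType k k = none := by simp [letterType]
      rw [fill, List.map_cons, this]
      exact sublist_cons_congr (P := WordAlternates) (fun _ _ h => h.tail) (ih h) _ t ht
    | some b =>
      obtain ⟨u, s', hu, hub, hs', rfl⟩ := h.exists_of_some_cons
      have hu' : u.map (letterType k) = List.replicate (u.length - 1 + 1) (some b) := by
        rw [List.eq_replicate_iff]
        constructor
        · have := List.length_pos_iff.2 hu
          simp
          omega
        · simp only [List.mem_map]
          rintro _ ⟨a, ha, rfl⟩
          exact letterType_of_onSide (hub a ha)
      rw [fill_some_cons, List.map_append, hu', sublist_replicate_append_iff ht]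
      exact sublist_cons_congr (P := WordAlternates) (fun _ _ h => h.tail) (ih hs') _ t ht

/-- Collapse the maximal segments of letters not on side `b` of `k` to a single `k`,
and delete such a segment at the end; `st` tells if a collapsed letter is pending. -/
def collapse (k : ℕ) (b : Bool) : Bool → List ℕ → List ℕ
  | _, [] => []
  | st, a :: l =>
    if OnSide k b a then (if st then [k, a] else [a]) ++ collapse k b false l
    else collapse k b true l

/-- No two adjacent letters `c`, and no letter `c` at the end. -/
def IsolatedLetter {α : Type*} (c : α) : List α → Prop
  | [] => True
  | u :: t => (u = c → ∃ v t', t = v :: t' ∧ v ≠ c) ∧ IsolatedLetter c t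

theorem sublist_cons_cons_iff {α : Type*} {c : α} {t : List α} (ht : IsolatedLetter c t)
    (l : List α) : t.Sublist (c :: c :: l) ↔ t.Sublist (c :: l) := by
  refine ⟨fun h => ?_, fun h => h.trans (List.sublist_cons_self _ _)⟩
  rw [List.sublist_cons_iff] at h
  rcases h with h | ⟨r, rfl, h⟩
  · exact h
  · obtain ⟨v, r, rfl, hv⟩ := ht.1 rfl
    rw [← List.singleton_append (l := l), cons_sublist_append_iff (by simpa using hv)] at h
    exact List.cons_sublist_cons.2 h

theorem sublist_collapse_iff {α : Type*} {k : ℕ} {b : Bool} {c : α} {φ : ℕ → α}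
    (hφ : ∀ a, ¬ OnSide k b a → φ a = c) (st : Bool) (l : List ℕ) (t : List α)
    (ht : IsolatedLetter c t) :
    t.Sublist (((if st then [k] else []) ++ l).map φ) ↔
      t.Sublist ((collapse k b st l).map φ) := by
  have hk : φ k = c := hφ k (not_onSide_self k b)
  induction l generalizing st t with
  | nil =>
    cases st
    · simp [collapse]
    · simp only [↓reduceIte, List.append_nil, List.map_cons, List.map_nil, hk, collapse]
      refine ⟨fun h => ?_, fun h => h.trans (by simp)⟩
      rw [List.sublist_singleton] at h
      rcases h with rfl | rfl
      · simp
      · simp [IsolatedLetter] at ht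
  | cons a l ih =>
    have key := sublist_cons_congr (P := IsolatedLetter c) (fun _ _ h => h.2)
      (fun t ht => ih false t ht)
    have hP : ∀ a t, IsolatedLetter c (a :: t) → IsolatedLetter c t := fun _ _ h => h.2
    by_cases ha : OnSide k b a
    · cases st
      · simpa [collapse, ha] using key (φ a) t ht
      · simpa [collapse, ha, hk] using sublist_cons_congr hP (key (φ a)) (φ k) t ht
    · rw [collapse, if_neg ha]
      refine Iff.trans ?_ (ih true t ht)
      cases st
      · simp [hφ a ha, hk]
      · simpa [hφ a ha, hk] using sublist_cons_cons_iff ht _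

theorem collapse_append {k : ℕ} {b : Bool} {u : List ℕ} (hub : ∀ a ∈ u, OnSide k b a)
    (l : List ℕ) : collapse k b false (u ++ l) = u ++ collapse k b false l := by
  induction u with
  | nil => rfl
  | cons a u ih =>
    simp [collapse, hub a (by simp), ih fun a h => hub a (by simp [h])]

theorem collapse_append_true {k : ℕ} {b : Bool} {u : List ℕ} (hu : u ≠ [])
    (hub : ∀ a ∈ u, OnSide k b a) (l : List ℕ) :
    collapse k b true (u ++ l) = k :: (u ++ collapse k b false l) := by
  cases u with
  | nil => exact absurd rfl hu
  | cons a u =>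
    simp [collapse, hub a (by simp), collapse_append fun c (h : c ∈ u) => hub c (by simp [h])]

theorem collapse_append_of_not {k : ℕ} {b : Bool} {u : List ℕ} (hu : u ≠ [])
    (hub : ∀ a ∈ u, ¬ OnSide k b a) (st : Bool) (l : List ℕ) :
    collapse k b st (u ++ l) = collapse k b true l := by
  induction u generalizing st with
  | nil => exact absurd rfl hu
  | cons a u ih =>
    rw [List.cons_append, collapse, if_neg (hub a (by simp))]
    by_cases h : u = []
    · simp [h]
    · exact ih h (fun a h => hub a (by simp [h])) _

theorem collapse_fill {k : ℕ} (b : Bool) {w : List (Option Bool)} {s : Bool → List (List ℕ)}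
    (h : Fits k w s) (hw : WordAlternates w) :
    collapse k b true (fill k w s) = (s b).flatMap (k :: ·) := by
  refine (Fits.rec' (k := k) (motive := fun w s =>
    collapse k b true (fill k w s) = (s b).flatMap (k :: ·) ∧
    (w.head? ≠ some (some b) → collapse k b false (fill k w s) = (s b).flatMap (k :: ·)))
    ?_ ?_ ?_ h hw).1
  · simp [fill, collapse]
  · intro w s _ _ ih
    simp [fill, collapse, ih, not_onSide_self]
  · intro b' w s u _ _ hb hu hub ih
    rw [fill_some_cons]
    by_cases hbb : b' = b
    · subst hbb
      simp [collapse_append_true hu hub, ih.2 hb]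
    · obtain rfl : b' = !b := by cases b <;> cases b' <;> simp_all
      have hub' : ∀ a ∈ u, ¬ OnSide k b a := fun a ha => by
        simpa using not_onSide_not (hub a ha)
      simp [collapse_append_of_not hu hub', ih.1]

/-- A sequence extending a canonical sequence with maximum `M` to a canonical sequence. -/
def CanonicalFrom : ℕ → List ℕ → Prop
  | _, [] => True
  | M, a :: l => 1 ≤ a ∧ a ≤ M + 1 ∧ CanonicalFrom (max M a) l

theorem canonicalFrom_iff_get (M : ℕ) (l : List ℕ) :
    CanonicalFrom M l ↔ ∀ i (h : i < l.length),
      1 ≤ l.get ⟨i, h⟩ ∧ l.get ⟨i, h⟩ ≤ max M ((l.take i).foldr max 0) + 1 := by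
  induction l generalizing M with
  | nil => simp [CanonicalFrom]
  | cons a l ih =>
    rw [CanonicalFrom, ih]
    constructor
    · rintro ⟨h1, h2, h3⟩ i h
      cases i with
      | zero => simpa using ⟨h1, h2⟩
      | succ i => simpa [max_assoc] using h3 i (by simpa using h)
    · intro h
      have h0 := h 0 (by simp)
      refine ⟨by simpa using h0.1, by simpa using h0.2, fun i hi => ?_⟩
      simpa [max_assoc] using h (i + 1) (by simpa using hi)

theorem isCanonicalSeq_iff (π : List ℕ) : IsCanonicalSeq π ↔ CanonicalFrom 0 π := by
  simp [canonicalFrom_iff_get, IsCanonicalSeq]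

theorem canonicalFrom_append (M : ℕ) (u l : List ℕ) :
    CanonicalFrom M (u ++ l) ↔ CanonicalFrom M u ∧ CanonicalFrom (u.foldl max M) l := by
  induction u generalizing M with
  | nil => simp [CanonicalFrom]
  | cons a u ih => simp [CanonicalFrom, ih, and_assoc]

theorem canonicalFrom_iff_filter {k M : ℕ} (hM : k ≤ M) (l : List ℕ) :
    CanonicalFrom M l ↔ (∀ a ∈ l, 1 ≤ a) ∧ CanonicalFrom M (l.filter (k < ·)) := by
  induction l generalizing M with
  | nil => simp [CanonicalFrom]
  | cons a l ih =>
    rw [CanonicalFrom, ih (hM.trans (le_max_left ..)), List.filter_cons, List.forall_mem_cons]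
    split_ifs with h
    · rw [CanonicalFrom]
      tauto
    · have : a ≤ M := by simp at h; omega
      rw [max_eq_left this]
      have : a ≤ M + 1 := by omega
      tauto

theorem CanonicalFrom.one_le {M : ℕ} {l : List ℕ} (h : CanonicalFrom M l) :
    ∀ a ∈ l, 1 ≤ a :=
  ((canonicalFrom_iff_filter (Nat.zero_le M) l).1 h).1

theorem CanonicalFrom.le_add_length {M : ℕ} {l : List ℕ} (h : CanonicalFrom M l) :
    ∀ a ∈ l, a ≤ M + l.length := by
  induction l generalizing M with
  | nil => simp
  | cons a l ih =>
    obtain ⟨h1, h2, h3⟩ := h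
    intro b hb
    rw [List.length_cons]
    rcases List.mem_cons.1 hb with rfl | hb
    · omega
    · have := ih h3 b hb
      omega

theorem CanonicalFrom.exists_split {M k : ℕ} {l : List ℕ} (h : CanonicalFrom M l) (hM : M < k) :
    ∃ u v, l = u ++ v ∧ (∀ a ∈ u, a < k) ∧ (v = [] ∨ ∃ v', v = k :: v') := by
  induction l generalizing M with
  | nil => exact ⟨[], [], by simp⟩
  | cons a l ih =>
    obtain ⟨h1, h2, h3⟩ := h
    by_cases ha : a < k
    · obtain ⟨u, v, rfl, hu, hv⟩ := ih h3 (max_lt hM ha)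
      exact ⟨a :: u, v, rfl, by simpa [ha] using hu, hv⟩
    · exact ⟨[], a :: l, rfl, by simp, .inr ⟨l, by rw [show a = k by omega]⟩⟩

theorem CanonicalFrom.cons_sublist {M a k : ℕ} {t l : List ℕ} (h : CanonicalFrom M l) (hM : M < a)
    (ha : a < k) (ht : (k :: t).Sublist l) : (a :: k :: t).Sublist l := by
  induction l generalizing M with
  | nil => simp at ht
  | cons b l ih =>
    obtain ⟨h1, h2, h3⟩ := h
    have hb : b ≠ k := by omega
    have ht' : (k :: t).Sublist l := by
      rwa [← List.singleton_append (l := l),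
        cons_sublist_append_iff (by simpa using hb.symm)] at ht
    by_cases hba : b = a
    · rw [hba]
      exact ht'.cons_cons a
    · exact (ih h3 (by omega) ht').cons b

/-- Split a word at the letters `none`. -/
def unflat : List (Option Bool) → List Bool × List (List Bool)
  | [] => ([], [])
  | none :: w => ([], (unflat w).1 :: (unflat w).2)
  | some b :: w => (b :: (unflat w).1, (unflat w).2)

theorem map_some_append_toFlat_unflat (w : List (Option Bool)) :
    (unflat w).1.map some ++ toFlat (unflat w).2 = w := by
  induction w with
  | nil => rfl
  | cons c w ih => cases c <;> simp [unflat, toFlat_cons, ih]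

theorem unflat_map_some_append (G : List Bool) (w : List (Option Bool)) :
    unflat (G.map some ++ w) = (G ++ (unflat w).1, (unflat w).2) := by
  induction G with
  | nil => rfl
  | cons b G ih => simp [unflat, ih]

theorem unflat_toFlat (g : List (List Bool)) : unflat (toFlat g) = ([], g) := by
  induction g with
  | nil => rfl
  | cons G g ih => simp [toFlat_cons, unflat, unflat_map_some_append, ih]

theorem isChain_map_some_iff (G : List Bool) :
    WordAlternates (G.map some) ↔ G.IsChain (· ≠ ·) := by
  simp [WordAlternates, List.isChain_map]

theorem wordAlternates_toFlat_iff (g : List (List Bool)) :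
    WordAlternates (toFlat g) ↔ GapsAlternate g := by
  induction g with
  | nil => simp [toFlat, GapsAlternate]
  | cons G g ih =>
    rw [toFlat_cons, gapsAlternate_cons, ← ih, ← isChain_map_some_iff]
    have h1 : WordAlternates (none :: (G.map some ++ toFlat g)) ↔
        WordAlternates (G.map some ++ toFlat g) := by
      simp [WordAlternates, List.isChain_cons]
    rw [h1, WordAlternates, List.isChain_append]
    refine and_congr_right fun _ => and_iff_left ?_
    intro y hy z hz hyz
    cases g with
    | nil => simp [toFlat] at hz
    | cons G' g =>
      rw [toFlat_cons] at hz
      simp at hz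
      rw [hyz, hz]

theorem count_none_toFlat (g : List (List Bool)) : (toFlat g).count none = g.length := by
  induction g with
  | nil => rfl
  | cons G g ih =>
    simp [toFlat_cons, ih, List.count_eq_zero.2 (none_notMem_map_some G)]

theorem count_some_toFlat (b : Bool) (g : List (List Bool)) :
    (toFlat g).count (some b) = g.flatten.count b := by
  induction g with
  | nil => rfl
  | cons G g ih =>
    simp [toFlat_cons, ih, List.count_map_of_injective G some (Option.some_injective _)]

/-- The sequence contains the level pattern at level `k`. -/
def LevelContains (x : Bool) (p q r k : ℕ) (π : List ℕ) : Prop :=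
  (levelPat x p q r).Sublist (π.map (letterType k))

theorem levelPat_eq_cons (x : Bool) (p q r : ℕ) :
    levelPat x p q r = none :: (List.replicate p none ++ some x ::
      (List.replicate q none ++ some (!x) :: List.replicate r none)) := by
  simp [levelPat, List.replicate_succ]

theorem LevelContains.mem {x : Bool} {p q r k : ℕ} {π : List ℕ}
    (h : LevelContains x p q r k π) : k ∈ π := by
  have : none ∈ π.map (letterType k) := h.subset (by simp [levelPat_eq_cons])
  obtain ⟨a, ha, h⟩ := List.mem_map.1 this
  have : a = k := by simpa [letterType] using h
  rwa [← this]

theorem wordAlternates_levelPat (x : Bool) (p q r : ℕ) : WordAlternates (levelPat x p q r) := by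
  have hrep : ∀ n, WordAlternates (List.replicate n none) := fun n =>
    List.isChain_replicate_of_rel n (fun _ => rfl)
  have hn : ∀ n y l, WordAlternates (some y :: l) →
      WordAlternates (List.replicate n none ++ some y :: l) := by
    intro n y l h
    refine List.isChain_append.2 ⟨hrep n, h, ?_⟩
    intro u hu v _ _
    exact List.eq_of_mem_replicate (List.mem_of_getLast? hu)
  refine hn _ _ _ (List.isChain_cons.2 ⟨?_, hn _ _ _ (List.isChain_cons.2 ⟨?_, hrep r⟩)⟩)
  · rintro y hy rfl
    cases q <;> cases x <;> simp [List.replicate_succ] at hy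
  · rintro y hy rfl
    cases r <;> simp [List.replicate_succ] at hy

theorem isolatedLetter_levelPat (x : Bool) (p q r : ℕ) :
    IsolatedLetter (some x) (levelPat x p q r) := by
  have h1 : ∀ n, IsolatedLetter (some x) (List.replicate n none) := by
    intro n
    induction n with
    | zero => trivial
    | succ n ih => exact ⟨by simp, ih⟩
  have h2 : ∀ n l, IsolatedLetter (some x) l →
      IsolatedLetter (some x) (List.replicate n none ++ l) := by
    intro n l h
    induction n with
    | zero => exact h
    | succ n ih => exact ⟨by simp, ih⟩
  refine h2 _ _ ⟨fun _ => ?_, h2 _ _ ⟨by simp, h1 r⟩⟩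
  cases q with
  | zero => exact ⟨_, _, rfl, by simp⟩
  | succ q => exact ⟨none, _, rfl, by simp⟩

/-- A sequence encoded by a prefix of small letters, a list of gaps and segments. -/
abbrev Code := List ℕ × List (List Bool) × (Bool → List (List ℕ))

/-- The sequence with a given code. -/
def assemble (k : ℕ) (d : Code) : List ℕ := d.1 ++ fill k (toFlat d.2.1) d.2.2

/-- The codes that describe sequences uniquely. -/
def GoodCode (k : ℕ) (d : Code) : Prop :=
  (∀ a ∈ d.1, a < k) ∧ GapsAlternate d.2.1 ∧ Fits k (toFlat d.2.1) d.2.2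

theorem assemble_injOn (k : ℕ) : Set.InjOn (assemble k) {d | GoodCode k d} := by
  have hP : ∀ d, GoodCode k d → (assemble k d).takeWhile (· < k) = d.1 := by
    rintro ⟨P, g, s⟩ ⟨h, -, -⟩
    have : (fill k (toFlat g) s).takeWhile (· < k) = [] := by
      cases g <;> simp [toFlat, fill]
    rw [assemble, List.takeWhile_append_of_pos (by simpa using h), this, List.append_nil]
  intro d hd d' hd' h
  have h1 : d.1 = d'.1 := by rw [← hP d hd, ← hP d' hd', h]
  have h2 := h
  rw [assemble, assemble, h1, List.append_cancel_left_eq] at h2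
  have h3 := congrArg (cut k) h2
  rw [cut_fill hd.2.2 ((wordAlternates_toFlat_iff _).2 hd.2.1),
    cut_fill hd'.2.2 ((wordAlternates_toFlat_iff _).2 hd'.2.1), Prod.mk.injEq] at h3
  have h4 := congrArg unflat h3.1
  rw [unflat_toFlat, unflat_toFlat, Prod.mk.injEq] at h4
  exact Prod.ext h1 (Prod.ext h4.2 h3.2)

theorem exists_assemble {k : ℕ} (hk : 0 < k) {π : List ℕ} (hπ : CanonicalFrom 0 π) :
    ∃ d, GoodCode k d ∧ assemble k d = π := by
  obtain ⟨u, v, rfl, hu, hv⟩ := hπ.exists_split hk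
  obtain ⟨h1, h2, h3⟩ := cut_spec k v
  have hw : toFlat (unflat (cut k v).1).2 = (cut k v).1 := by
    have := map_some_append_toFlat_unflat (cut k v).1
    rcases hv with rfl | ⟨v, rfl⟩
    · simp [cut, unflat, toFlat]
    · simpa [cut, unflat] using this
  refine ⟨(u, (unflat (cut k v).1).2, (cut k v).2), ⟨hu, ?_, ?_⟩, ?_⟩
  · rwa [← wordAlternates_toFlat_iff, hw]
  · rwa [hw]
  · simp [assemble, hw, h3]

section Invariance

variable {k : ℕ} {P : List ℕ} {g g' : List (List Bool)} {s : Bool → List (List ℕ)}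

theorem GoodCode.of_sameStat (h : GoodCode k (P, g, s)) (hs : SameStat g' g)
    (hg' : GapsAlternate g') : GoodCode k (P, g', s) := by
  refine ⟨h.1, hg', fun b => ?_⟩
  have := h.2.2 b
  rw [count_some_toFlat] at this ⊢
  rwa [hs.2 b]

theorem assemble_perm (h : GoodCode k (P, g, s)) (h' : GoodCode k (P, g', s))
    (hs : SameStat g' g) : (assemble k (P, g', s)).Perm (assemble k (P, g, s)) := by
  have h1 := fill_perm h.2.2
  have h2 := fill_perm h'.2.2
  simp only [count_none_toFlat] at h1 h2
  rw [hs.1] at h2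
  exact (h2.trans h1.symm).append_left P

theorem canonicalFrom_assemble_iff {M : ℕ} (h : GoodCode k (P, g, s)) :
    CanonicalFrom M (assemble k (P, g, s)) ↔ CanonicalFrom M P ∧ (g ≠ [] →
      k ≤ P.foldl max M + 1 ∧ (∀ a ∈ assemble k (P, g, s), 1 ≤ a) ∧
      CanonicalFrom (max (P.foldl max M) k) (s true).flatten) := by
  rw [assemble, canonicalFrom_append]
  refine and_congr_right fun hP => ?_
  have hf := filter_fill h.2.2
  simp only at hf ⊢
  cases g with
  | nil => simp [toFlat, fill, CanonicalFrom]
  | cons G g =>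
    rw [toFlat_cons, fill] at hf ⊢
    rw [CanonicalFrom, canonicalFrom_iff_filter (le_max_right _ k)]
    rw [List.filter_cons_of_neg (by simp)] at hf
    rw [hf]
    simp only [List.forall_mem_append, List.forall_mem_cons, ne_eq, reduceCtorEq,
      not_false_eq_true, forall_const]
    have := hP.one_le
    tauto

theorem canonicalFrom_assemble_congr {M : ℕ} (h : GoodCode k (P, g, s))
    (h' : GoodCode k (P, g', s)) (hs : SameStat g' g) :
    CanonicalFrom M (assemble k (P, g', s)) ↔ CanonicalFrom M (assemble k (P, g, s)) := by
  rw [canonicalFrom_assemble_iff h, canonicalFrom_assemble_iff h']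
  have h1 : g' ≠ [] ↔ g ≠ [] := by
    rw [← List.length_pos_iff, ← List.length_pos_iff, hs.1]
  simp only [h1, (assemble_perm h h' hs).mem_iff]

theorem collapse_append_congr {k : ℕ} {b : Bool} {l l' : List ℕ}
    (h : ∀ st, collapse k b st l = collapse k b st l') (u : List ℕ) (st : Bool) :
    collapse k b st (u ++ l) = collapse k b st (u ++ l') := by
  induction u generalizing st with
  | nil => exact h st
  | cons a u ih => simp [collapse, ih]

theorem collapse_fill_toFlat {b : Bool} {G : List Bool} (h : Fits k (toFlat (G :: g)) s)
    (hg : GapsAlternate (G :: g)) (st : Bool) :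
    collapse k b st (fill k (toFlat (G :: g)) s) = (s b).flatMap (k :: ·) := by
  rw [← wordAlternates_toFlat_iff] at hg
  rw [toFlat_cons] at hg h ⊢
  rw [fill, collapse, if_neg (not_onSide_self k b)]
  exact collapse_fill b (fits_none_cons.1 h) hg.tail

theorem levelContains_assemble_congr {j p q r : ℕ} {b : Bool} (hj : OnSide k b j)
    (h : GoodCode k (P, g, s)) (h' : GoodCode k (P, g', s)) (hs : SameStat g' g) :
    LevelContains (!b) p q r j (assemble k (P, g', s)) ↔
      LevelContains (!b) p q r j (assemble k (P, g, s)) := by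
  have hφ : ∀ a, ¬ OnSide k b a → letterType j a = some (!b) := by
    intro a ha
    apply letterType_of_onSide
    cases b <;> simp [OnSide] at * <;> omega
  have key : ∀ l : List ℕ, (levelPat (!b) p q r).Sublist (l.map (letterType j)) ↔
      (levelPat (!b) p q r).Sublist ((collapse k b false l).map (letterType j)) := fun l => by
    simpa using sublist_collapse_iff (k := k) hφ false l _ (isolatedLetter_levelPat (!b) p q r)
  unfold LevelContains
  refine (key _).trans (Iff.trans (iff_of_eq ?_) (key _).symm)
  congr 2
  refine collapse_append_congr (fun st => ?_) P false
  have h1 := hs.1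
  cases g with
  | nil =>
    cases g' with
    | nil => rfl
    | cons G' g' => simp at h1
  | cons G g =>
    cases g' with
    | nil => simp at h1
    | cons G' g' =>
      rw [collapse_fill_toFlat h.2.2 h.2.1, collapse_fill_toFlat h'.2.2 h'.2.1]

theorem levelContains_assemble_self {x : Bool} {p q r : ℕ} (h : GoodCode k (P, g, s)) :
    LevelContains x p q r k (assemble k (P, g, s)) ↔ ¬ GapAvoids x p q r g := by
  rw [LevelContains, GapAvoids, not_not, ← sublist_map_fill_iff h.2.2 _
    (wordAlternates_levelPat x p q r), assemble, List.map_append, levelPat_eq_cons,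
    cons_sublist_append_iff]
  simp only [List.mem_map, not_exists, not_and]
  intro a ha hak
  have := h.1 a ha
  have : a = k := by simpa [letterType] using hak
  omega

end Invariance

/-- Canonical sequences avoiding one level pattern below level `K`, and another one from there. -/
def Hybrid (p q r p' q' r' n K : ℕ) : Set (List ℕ) :=
  {π | π.length = n ∧ CanonicalFrom 0 π ∧ (∀ j < K, ¬ LevelContains true p' q' r' j π) ∧
    ∀ j ≥ K, ¬ LevelContains false p q r j π}

theorem image_assemble_hybrid {k : ℕ} (hk : 0 < k) (p q r p' q' r' n K : ℕ) :
    Set.image (assemble k) {d | GoodCode k d ∧ assemble k d ∈ Hybrid p q r p' q' r' n K} =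
      Hybrid p q r p' q' r' n K := by
  ext π
  constructor
  · rintro ⟨d, ⟨_, h⟩, rfl⟩
    exact h
  · intro h
    obtain ⟨d, hd, rfl⟩ := exists_assemble hk h.2.1
    exact ⟨d, ⟨hd, h⟩, rfl⟩

theorem ncard_hybrid_eq_ncard_code {k : ℕ} (hk : 0 < k) (p q r p' q' r' n K : ℕ) :
    (Hybrid p q r p' q' r' n K).ncard =
      {d | GoodCode k d ∧ assemble k d ∈ Hybrid p q r p' q' r' n K}.ncard := by
  rw [← image_assemble_hybrid hk, Set.InjOn.ncard_image
    ((assemble_injOn k).mono fun d hd => hd.1), image_assemble_hybrid hk]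

theorem ncard_hybrid_succ {p q r p' q' r' : ℕ} (ht : p + q + r = p' + q' + r') (n k : ℕ) :
    (Hybrid p q r p' q' r' n k).ncard = (Hybrid p q r p' q' r' n (k + 1)).ncard := by
  rcases Nat.eq_zero_or_pos k with rfl | hk
  · congr 1
    ext π
    have h0 : CanonicalFrom 0 π → ∀ x p q r, ¬ LevelContains x p q r 0 π :=
      fun hc x p q r h => absurd (hc.one_le 0 h.mem) (by simp)
    refine and_congr_right fun _ => and_congr_right fun hc => ?_
    refine and_congr (by simp [h0 hc]) ⟨fun h j hj => h j (Nat.zero_le j), fun h j _ => ?_⟩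
    rcases Nat.eq_zero_or_pos j with rfl | hj
    · exact h0 hc _ _ _ _
    · exact h j hj
  rw [ncard_hybrid_eq_ncard_code hk, ncard_hybrid_eq_ncard_code hk]
  have hiff : ∀ P g s, GoodCode k (P, g, s) → ∀ g', GoodCode k (P, g', s) → SameStat g' g →
      assemble k (P, g, s) ∈ Hybrid p q r p' q' r' n k → GapAvoids true p' q' r' g' →
      assemble k (P, g', s) ∈ Hybrid p q r p' q' r' n (k + 1) := by
    rintro P g s h g' h' hs ⟨h1, h2, h3, h4⟩ hg'
    refine ⟨(assemble_perm h h' hs).length_eq.trans h1,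
      (canonicalFrom_assemble_congr h h' hs).2 h2, fun j hj => ?_, fun j hj => ?_⟩
    · rcases Nat.lt_succ_iff_lt_or_eq.1 hj with hj | rfl
      · exact (levelContains_assemble_congr (b := false) hj h h' hs).not.2 (h3 j hj)
      · rwa [levelContains_assemble_self h', not_not]
    · exact (levelContains_assemble_congr (b := true) (Nat.lt_of_succ_le hj) h h' hs).not.2
        (h4 j (by omega))
  have hiff' : ∀ P g s, GoodCode k (P, g, s) → ∀ g', GoodCode k (P, g', s) → SameStat g' g →
      assemble k (P, g, s) ∈ Hybrid p q r p' q' r' n (k + 1) → GapAvoids false p q r g' →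
      assemble k (P, g', s) ∈ Hybrid p q r p' q' r' n k := by
    rintro P g s h g' h' hs ⟨h1, h2, h3, h4⟩ hg'
    refine ⟨(assemble_perm h h' hs).length_eq.trans h1,
      (canonicalFrom_assemble_congr h h' hs).2 h2, fun j hj => ?_, fun j hj => ?_⟩
    · exact (levelContains_assemble_congr (b := false) hj h h' hs).not.2 (h3 j (by omega))
    · rcases hj.lt_or_eq with hj | rfl
      · exact (levelContains_assemble_congr (b := true) hj h h' hs).not.2 (h4 j hj)
      · rwa [levelContains_assemble_self h', not_not]
  have havoid : ∀ P g s, GoodCode k (P, g, s) →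
      assemble k (P, g, s) ∈ Hybrid p q r p' q' r' n k → GapAvoids false p q r g :=
    fun P g s h hH => by
      have := hH.2.2.2 k le_rfl
      rwa [levelContains_assemble_self h, not_not] at this
  have havoid' : ∀ P g s, GoodCode k (P, g, s) →
      assemble k (P, g, s) ∈ Hybrid p q r p' q' r' n (k + 1) → GapAvoids true p' q' r' g :=
    fun P g s h hH => by
      have := hH.2.2.1 k (Nat.lt_succ_self k)
      rwa [levelContains_assemble_self h, not_not] at this
  obtain ⟨f, f', hf, hf'⟩ := statEquiv_gapAvoids false true ht
  refine Set.ncard_congr (fun d _ => (d.1, f d.2.1, d.2.2)) ?_ ?_ ?_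
  · rintro ⟨P, g, s⟩ ⟨h, hH⟩
    obtain ⟨h1, h2, h3, -⟩ := hf g h.2.1 (havoid P g s h hH)
    have h' := h.of_sameStat h2 h1
    exact ⟨h', hiff P g s h _ h' h2 hH h3⟩
  · rintro ⟨P, g, s⟩ ⟨P', g', s'⟩ ⟨h, hH⟩ ⟨h', hH'⟩ he
    simp only [Prod.mk.injEq] at he ⊢
    refine ⟨he.1, ?_, he.2.2⟩
    rw [← (hf g h.2.1 (havoid P g s h hH)).2.2.2, he.2.1,
      (hf g' h'.2.1 (havoid P' g' s' h' hH')).2.2.2]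
  · rintro ⟨P, g, s⟩ ⟨h, hH⟩
    obtain ⟨h1, h2, h3, h4⟩ := hf' g h.2.1 (havoid' P g s h hH)
    have h' := h.of_sameStat h2 h1
    exact ⟨(P, f' g, s), ⟨h', hiff' P g s h _ h' h2 hH h3⟩, by simp [h4]⟩

theorem containsPat_iff (π σ : List ℕ) : ContainsPat π σ ↔
    ∃ φ : ℕ → ℕ, (∀ u ∈ σ, ∀ v ∈ σ, u < v ↔ φ u < φ v) ∧ (σ.map φ).Sublist π := by
  constructor
  · rintro ⟨f, hf, h⟩
    classical
    have heq : ∀ i j, σ.get i = σ.get j → π.get (f i) = π.get (f j) := by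
      intro i j hij
      have h1 := h i j
      have h2 := h j i
      omega
    have hφ : ∃ φ : ℕ → ℕ, ∀ i, φ (σ.get i) = π.get (f i) := by
      refine ⟨fun v => if hv : ∃ i, σ.get i = v then π.get (f hv.choose) else 0, fun i => ?_⟩
      have hv : ∃ j, σ.get j = σ.get i := ⟨i, rfl⟩
      simp only [dif_pos hv]
      exact heq _ _ hv.choose_spec
    obtain ⟨φ, hφ⟩ := hφ
    refine ⟨φ, fun u hu v hv => ?_, ?_⟩
    · obtain ⟨i, rfl⟩ := List.get_of_mem hu
      obtain ⟨j, rfl⟩ := List.get_of_mem hv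
      rw [hφ, hφ]
      exact h i j
    · rw [List.sublist_iff_exists_fin_orderEmbedding_get_eq]
      refine ⟨OrderEmbedding.ofStrictMono (fun i => f (Fin.cast (by simp) i))
        fun i j hij => hf (by simpa using hij), fun i => ?_⟩
      have := hφ (Fin.cast (by simp) i)
      simp only [List.get_eq_getElem, List.getElem_map, Fin.val_cast] at this ⊢
      exact this
  · rintro ⟨φ, hφ, h⟩
    rw [List.sublist_iff_exists_fin_orderEmbedding_get_eq] at h
    obtain ⟨f, hf⟩ := h
    refine ⟨fun i => f (Fin.cast (by simp) i), fun i j hij => f.strictMono (by simpa using hij),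
      fun i j => ?_⟩
    rw [← hf, ← hf, hφ _ (List.get_mem ..) _ (List.get_mem ..)]
    simp

theorem levelContains_iff {x : Bool} {p q r k : ℕ} {π : List ℕ} :
    LevelContains x p q r k π ↔ ∃ y z, OnSide k x y ∧ OnSide k (!x) z ∧
      (List.replicate (p + 1) k ++ y :: (List.replicate q k ++ z :: List.replicate r k)).Sublist
        π := by
  have hnone : ∀ {a}, letterType k a = none → a = k := fun h => by simpa [letterType] using h
  have hsome : ∀ {a b}, letterType k a = some b → OnSide k b a := by
    intro a b h
    have hne : a ≠ k := by rintro rfl; simp [letterType] at h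
    have : decide (k < a) = b := by simpa [letterType, hne] using h
    rw [← this]
    exact onSide_decide hne
  have hrep : ∀ {n l}, List.replicate n none = l.map (letterType k) → l = List.replicate n k := by
    intro n l h
    have h := h.symm
    rw [List.eq_replicate_iff] at h ⊢
    refine ⟨by simpa using h.1, fun a ha => hnone (h.2 _ (List.mem_map_of_mem ha))⟩
  unfold LevelContains levelPat
  rw [List.sublist_map_iff]
  constructor
  · rintro ⟨t, ht, h⟩
    obtain ⟨t₁, t₂, rfl, h1, h2⟩ := List.map_eq_append_iff.1 h.symm
    obtain ⟨y, t₃, rfl, hy, h3⟩ := List.map_eq_cons_iff.1 h2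
    obtain ⟨t₄, t₅, rfl, h4, h5⟩ := List.map_eq_append_iff.1 h3
    obtain ⟨z, t₆, rfl, hz, h6⟩ := List.map_eq_cons_iff.1 h5
    rw [hrep h1.symm, hrep h4.symm, hrep h6.symm] at ht
    exact ⟨y, z, hsome hy, hsome hz, ht⟩
  · rintro ⟨y, z, hy, hz, h⟩
    refine ⟨_, h, ?_⟩
    have : letterType k k = none := by simp [letterType]
    simp [letterType_of_onSide hy, letterType_of_onSide hz, this]

/-- The patterns of `SigmaSet`, of either kind. -/
def sigmaPat (x : Bool) (p q r : ℕ) : List ℕ :=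
  1 :: (List.replicate (p + 1) 2 ++ (if x then 3 else 1) ::
    (List.replicate q 2 ++ (if x then 1 else 3) :: List.replicate r 2))

theorem containsPat_sigmaPat_iff {π : List ℕ} (hπ : CanonicalFrom 0 π) (x : Bool) (p q r : ℕ) :
    ContainsPat π (sigmaPat x p q r) ↔ ∃ k, LevelContains x p q r k π := by
  rw [containsPat_iff]
  constructor
  · rintro ⟨φ, hφ, h⟩
    have h1 : φ 1 < φ 2 := (hφ 1 (by simp [sigmaPat]) 2 (by simp [sigmaPat])).1 (by simp)
    have h3 : φ 2 < φ 3 := by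
      refine (hφ 2 (by simp [sigmaPat]) 3 ?_).1 (by simp)
      cases x <;> simp [sigmaPat]
    refine ⟨φ 2, levelContains_iff.2 ⟨φ (if x then 3 else 1), φ (if x then 1 else 3), ?_, ?_, ?_⟩⟩
    · cases x <;> simpa [OnSide]
    · cases x <;> simpa [OnSide]
    · simp only [sigmaPat, List.map_cons, List.map_append, List.map_replicate] at h
      exact (List.sublist_cons_self _ _).trans h
  · rintro ⟨k, hk⟩
    obtain ⟨y, z, hy, hz, h⟩ := levelContains_iff.1 hk
    obtain ⟨a, c, hak, hkc, hyac, hzac, ha⟩ : ∃ a c, a < k ∧ k < c ∧ y = (if x then c else a) ∧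
        z = (if x then a else c) ∧ a ∈ π := by
      have hyπ : y ∈ π := h.subset (by simp)
      have hzπ : z ∈ π := h.subset (by simp)
      cases x
      · exact ⟨y, z, hy, hz, rfl, rfl, hyπ⟩
      · exact ⟨z, y, hz, hy, rfl, rfl, hzπ⟩
    refine ⟨fun v => if v = 1 then a else if v = 2 then k else c, ?_, ?_⟩
    · have hmem : ∀ u ∈ sigmaPat x p q r, u = 1 ∨ u = 2 ∨ u = 3 := by
        intro u hu
        cases x <;> simp [sigmaPat] at hu <;> tauto
      intro u hu v hv
      rcases hmem u hu with rfl | rfl | rfl <;> rcases hmem v hv with rfl | rfl | rfl <;>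
        simp <;> omega
    · rw [List.replicate_succ, List.cons_append] at h
      have := hπ.cons_sublist (hπ.one_le a ha) hak h
      rw [hyac, hzac] at this
      cases x <;> simpa [sigmaPat, List.replicate_succ] using this

theorem pAvoid_sigmaPat_eq {p q r p' q' r' : ℕ} (ht : p + q + r = p' + q' + r') (n : ℕ) :
    pAvoid n (sigmaPat false p q r) = pAvoid n (sigmaPat true p' q' r') := by
  have h1 : {π : List ℕ | π.length = n ∧ IsCanonicalSeq π ∧ AvoidsPat π (sigmaPat false p q r)} =
      Hybrid p q r p' q' r' n 0 := by
    ext π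
    refine and_congr_right fun _ => ?_
    rw [isCanonicalSeq_iff]
    refine and_congr_right fun hc => ?_
    rw [AvoidsPat, containsPat_sigmaPat_iff hc]
    simp
  have h2 : {π : List ℕ | π.length = n ∧ IsCanonicalSeq π ∧ AvoidsPat π (sigmaPat true p' q' r')} =
      Hybrid p q r p' q' r' n (n + 1) := by
    ext π
    refine and_congr_right fun hn => ?_
    rw [isCanonicalSeq_iff]
    refine and_congr_right fun hc => ?_
    have hle : ∀ {x p q r j}, LevelContains x p q r j π → j < n + 1 := fun h => by
      have := hc.le_add_length _ h.mem
      omega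
    rw [AvoidsPat, containsPat_sigmaPat_iff hc, not_exists]
    refine ⟨fun h => ⟨fun j _ => h j, fun j hj h' => ?_⟩, fun h j h' => h.1 j (hle h') h'⟩
    exact absurd (hle h') (by omega)
  rw [pAvoid, pAvoid, h1, h2]
  generalize n + 1 = K
  induction K with
  | zero => rfl
  | succ K ih => rw [ih, ncard_hybrid_succ ht]

theorem exists_eq_sigmaPat {t : ℕ} {σ : List ℕ} (h : σ ∈ SigmaSet t) :
    ∃ x p q r, p + q + r = t ∧ σ = sigmaPat x p q r := by
  obtain ⟨p, q, r, ht, rfl | rfl⟩ := h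
  · exact ⟨false, p, q, r, ht, by simp [sigmaPat]⟩
  · exact ⟨true, p, q, r, ht, by simp [sigmaPat]⟩

/-- For a fixed t ≥ 0, all patterns in Σ are equivalent. -/
theorem statement13 (t : ℕ) (σ σ' : List ℕ)
    (h : σ ∈ SigmaSet t) (h' : σ' ∈ SigmaSet t) :
    PatEquiv σ σ' := by
  obtain ⟨x, p, q, r, ht, rfl⟩ := exists_eq_sigmaPat h
  obtain ⟨x', p', q', r', ht', rfl⟩ := exists_eq_sigmaPat h'
  have key : ∀ x p q r, p + q + r = t → ∀ n,
      pAvoid n (sigmaPat x p q r) = pAvoid n (sigmaPat true t 0 0) := by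
    intro x p q r ht n
    cases x
    · exact pAvoid_sigmaPat_eq ht n
    · exact (pAvoid_sigmaPat_eq (p := t) (q := 0) (r := 0) ht.symm n).symm.trans
        (pAvoid_sigmaPat_eq rfl n)
  exact fun n => (key x p q r ht n).trans (key x' p' q' r' ht' n).symm
end

section
/- The pattern 12^{p+2}12^q32^r is equivalent to the pattern 12^{p+1}12^q32^{r+1} for all integers p, q, r ≥ 0. -/
open scoped List

/-- Occurrences of `lt` (resp. `gt`) are never adjacent. -/
def Spread (σ : List Ordering) : Prop := σ.IsChain (fun x y => x ≠ y ∨ x = .eq)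

/-- A spread word that neither starts with `gt` nor ends with `lt`. -/
def Core (v : List Ordering) : Prop :=
  Spread v ∧ v.head? ≠ some .gt ∧ v.getLast? ≠ some .lt

/-- `v` with an optional `gt` in front and an optional `lt` at the end. -/
def wrap (g : Bool) (v : List Ordering) (l : Bool) : List Ordering :=
  (if g then [.gt] else []) ++ (v ++ (if l then [.lt] else []))

/-- The word `(lt gt)^k`. -/
def alt : ℕ → List Ordering
  | 0 => []
  | k + 1 => .lt :: .gt :: alt k

/-- `l` is a shortest word with `s` occurrences of `eq`. -/
inductive EqPrefix : ℕ → List Ordering → Prop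
  | nil : EqPrefix 0 []
  | skip {s x l} : x ≠ .eq → EqPrefix (s + 1) l → EqPrefix (s + 1) (x :: l)
  | hit {s l} : EqPrefix s l → EqPrefix (s + 1) (.eq :: l)

/-- Reverse a word and exchange `lt` with `gt`. -/
def revSwap (σ : List Ordering) : List Ordering := (σ.map Ordering.swap).reverse

/-- The shape `eq^s lt eq^q gt eq^r`. -/
def shapePat (s q r : ℕ) : List Ordering :=
  List.replicate s .eq ++ (.lt :: (List.replicate q .eq ++ (.gt :: List.replicate r .eq)))

/-- The correspondence between shapes avoiding `shapePat (s + 1) q r` and shapes avoiding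
`shapePat s q (r + 1)`. -/
def ShapeRel (s r : ℕ) (σ τ : List Ordering) : Prop :=
  (σ = τ ∧ σ.count .eq ≤ s + r) ∨
  ∃ a b g₀ k l v g l₁, EqPrefix s a ∧ EqPrefix r b.reverse ∧ Core v ∧
    σ = a ++ ((wrap g₀ (alt k) l ++ .eq :: wrap g v l₁) ++ b) ∧
    τ = a ++ ((wrap g₀ v l ++ .eq :: wrap g (alt k) l₁) ++ b)

theorem EqPrefix.count {s l} (h : EqPrefix s l) : l.count .eq = s := by
  induction h with
  | nil => rfl
  | skip hx _ ih => simp [ih, hx]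
  | hit _ ih => simp [ih]

theorem EqPrefix.map_swap {s l} (h : EqPrefix s l) : EqPrefix s (l.map Ordering.swap) := by
  induction h with
  | nil => exact .nil
  | @skip s x l hx _ ih => exact .skip (by cases x <;> simp_all) ih
  | hit _ ih => exact .hit ih

theorem EqPrefix.append_inj {s a a'} (h : EqPrefix s a) (h' : EqPrefix s a') :
    ∀ {y y'}, a ++ y = a' ++ y' → a = a' ∧ y = y' := by
  induction h generalizing a' with
  | nil => cases h'; simp
  | skip hx h ih =>
    intro y y' e
    cases h' with
    | skip hx' h' =>
      simp only [List.cons_append, List.cons.injEq] at e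
      have := ih h' e.2
      simp [this, e.1]
    | hit h' => simp at e; exact absurd e.1 hx
  | hit h ih =>
    intro y y' e
    cases h' with
    | skip hx' h' => simp at e; exact absurd e.1.symm hx'
    | hit h' =>
      simp only [List.cons_append, List.cons.injEq] at e
      have := ih h' e.2
      simp [this]

theorem exists_eqPrefix {s : ℕ} {σ : List Ordering} (h : s ≤ σ.count .eq) :
    ∃ a y, EqPrefix s a ∧ σ = a ++ y := by
  induction σ generalizing s with
  | nil => simp at h; subst h; exact ⟨[], [], .nil, rfl⟩
  | cons x σ ih =>
    cases s with
    | zero => exact ⟨[], _, .nil, rfl⟩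
    | succ s =>
      by_cases hx : x = .eq
      · subst hx
        obtain ⟨a, y, ha, e⟩ := ih (s := s) (by simpa using h)
        exact ⟨_, y, .hit ha, by simp [e]⟩
      · obtain ⟨a, y, ha, e⟩ := ih (s := s + 1) (by simpa [List.count_cons, hx] using h)
        exact ⟨_, y, .skip hx ha, by simp [e]⟩

theorem EqPrefix.of_not_mem {u : List Ordering} (h : .eq ∉ u) : EqPrefix 1 (u ++ [.eq]) := by
  induction u with
  | nil => exact .hit .nil
  | cons x u ih =>
    simp at h
    exact .skip (fun e => h.1 e.symm) (ih (by simpa using h.2))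

theorem EqPrefix.append {s t a b} (h : EqPrefix s a) (h' : EqPrefix t b) :
    EqPrefix (s + t) (a ++ b) := by
  induction h with
  | nil => simpa
  | @skip s x l hx _ ih =>
    rw [show s + 1 + t = s + t + 1 by omega] at ih ⊢
    exact .skip hx ih
  | @hit s l _ ih =>
    rw [show s + 1 + t = s + t + 1 by omega]
    exact .hit ih

theorem EqPrefix.exists_first {s a} (h : EqPrefix (s + 1) a) :
    ∃ u y, .eq ∉ u ∧ a = u ++ .eq :: y := by
  have : .eq ∈ a := List.count_pos_iff.1 (by rw [h.count]; omega)
  obtain ⟨u, y, e, hu⟩ := List.eq_append_cons_of_mem this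
  exact ⟨u, y, hu, e⟩

theorem EqPrefix.eq_nil_or_concat {s a} (h : EqPrefix s a) : a = [] ∨ ∃ u, a = u ++ [.eq] := by
  induction h with
  | nil => simp
  | @skip s x l hx h ih =>
    obtain rfl | ⟨u, rfl⟩ := ih
    · cases h
    · exact .inr ⟨x :: u, by simp⟩
  | @hit s l h ih =>
    obtain rfl | ⟨u, rfl⟩ := ih
    · exact .inr ⟨[], by simp⟩
    · exact .inr ⟨.eq :: u, by simp⟩

theorem EqPrefix.sublist_of_append {s a} (h : EqPrefix s a) {x y : List Ordering}
    (hs : List.replicate s .eq ++ x <+ a ++ y) : x <+ y := by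
  induction h with
  | nil => simpa using hs
  | skip hx _ ih =>
    apply ih
    rw [List.replicate_succ, List.cons_append, List.cons_append] at hs
    cases hs with
    | cons _ h => simpa [List.replicate_succ] using h
    | cons_cons _ h => exact absurd rfl hx
  | hit _ ih =>
    apply ih
    simpa [List.replicate_succ] using hs

theorem EqPrefix.replicate_sublist {s a} (h : EqPrefix s a) : List.replicate s .eq <+ a :=
  List.replicate_sublist_iff.2 h.count.ge

theorem spread_append_eq_cons {x y : List Ordering} :
    Spread (x ++ .eq :: y) ↔ Spread x ∧ Spread y := by
  simp only [Spread, List.isChain_append, List.isChain_cons]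
  constructor
  · rintro ⟨h1, h2, h3⟩
    exact ⟨h1, h2.2⟩
  · rintro ⟨h1, h2⟩
    refine ⟨h1, ⟨by simp, h2⟩, ?_⟩
    simp only [List.head?_cons, Option.mem_def, Option.some.injEq]
    rintro z - _ rfl
    cases z <;> simp

theorem EqPrefix.spread_append {s a} (h : EqPrefix s a) {y : List Ordering} :
    Spread (a ++ y) ↔ Spread a ∧ Spread y := by
  obtain rfl | ⟨u, rfl⟩ := h.eq_nil_or_concat
  · simp [Spread]
  · have := spread_append_eq_cons (x := u) (y := [])
    simp only [List.append_assoc, List.cons_append, List.nil_append, spread_append_eq_cons, this]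
    simp [Spread]

theorem spread_revSwap {σ : List Ordering} : Spread (revSwap σ) ↔ Spread σ := by
  unfold Spread revSwap
  rw [List.isChain_reverse, List.isChain_map]
  apply iff_of_eq
  congr 1
  ext x y
  cases x <;> cases y <;> simp

theorem revSwap_revSwap (σ : List Ordering) : revSwap (revSwap σ) = σ := by
  simp [revSwap, List.map_reverse, Function.comp_def]

theorem revSwap_append (σ τ : List Ordering) : revSwap (σ ++ τ) = revSwap τ ++ revSwap σ := by
  simp [revSwap]

theorem EqPrefix.spread_append' {s b} (h : EqPrefix s b.reverse) {y : List Ordering} :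
    Spread (y ++ b) ↔ Spread y ∧ Spread b := by
  have : EqPrefix s (revSwap b) := by
    have := h.map_swap
    rwa [List.map_reverse] at this
  rw [← spread_revSwap, revSwap_append, this.spread_append, spread_revSwap, spread_revSwap,
    and_comm]

theorem core_revSwap {v : List Ordering} : Core (revSwap v) ↔ Core v := by
  have h1 : (revSwap v).head? ≠ some .gt ↔ v.getLast? ≠ some .lt := by
    simp only [revSwap, List.head?_reverse, List.getLast?_map]
    cases v.getLast? with
    | none => simp
    | some x => cases x <;> simp
  have h2 : (revSwap v).getLast? ≠ some .lt ↔ v.head? ≠ some .gt := by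
    simp only [revSwap, List.getLast?_reverse, List.head?_map]
    cases v.head? with
    | none => simp
    | some x => cases x <;> simp
  rw [Core, Core, h1, h2, spread_revSwap]
  tauto

theorem revSwap_wrap (g v l) : revSwap (wrap g v l) = wrap l (revSwap v) g := by
  cases g <;> cases l <;> simp [wrap, revSwap]

theorem core_alt (k : ℕ) : Core (alt k) := by
  induction k with
  | zero => simp [Core, alt, Spread]
  | succ k ih =>
    obtain ⟨h1, h2, h3⟩ := ih
    refine ⟨?_, by simp [alt], ?_⟩
    · simp only [Spread, alt, List.isChain_cons]
      refine ⟨by simp, ?_, h1⟩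
      intro y hy
      left
      rintro rfl
      exact h2 hy
    · cases k with
      | zero => simp [alt]
      | succ k => simpa [alt] using h3

theorem eq_notMem_alt (k : ℕ) : .eq ∉ alt k := by
  induction k with
  | zero => simp [alt]
  | succ k ih => simpa [alt] using ih

theorem Core.exists_alt {v : List Ordering} (h : Core v) (hv : .eq ∉ v) : ∃ k, v = alt k := by
  induction hn : v.length using Nat.strong_induction_on generalizing v with
  | _ n ih =>
  obtain ⟨h1, h2, h3⟩ := h
  match v with
  | [] => exact ⟨0, rfl⟩
  | .eq :: _ => simp at hv
  | .gt :: _ => simp at h2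
  | [.lt] => simp at h3
  | .lt :: .lt :: _ => simp [Spread] at h1
  | .lt :: .eq :: _ => simp at hv
  | .lt :: .gt :: w =>
    simp only [Spread, List.isChain_cons] at h1
    have hw : Core w := by
      refine ⟨h1.2.2, fun e => by simpa using h1.2.1 .gt e, ?_⟩
      cases w with
      | nil => simp
      | cons x w => simpa using h3
    obtain ⟨k, rfl⟩ := ih w.length (by simp at hn; omega) hw (by simpa using hv) rfl
    exact ⟨k + 1, rfl⟩

theorem alt_injective : Function.Injective alt := by
  have hl : ∀ k, (alt k).length = 2 * k := by
    intro k
    induction k with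
    | zero => rfl
    | succ k ih => simp [alt, ih]; omega
  intro k k' e
  have := congrArg List.length e
  rw [hl, hl] at this
  omega

theorem revSwap_alt (k : ℕ) : revSwap (alt k) = alt k := by
  obtain ⟨m, hm⟩ := (core_revSwap.2 (core_alt k)).exists_alt (by
    simp only [revSwap, List.mem_reverse, List.mem_map, not_exists, not_and]
    rintro x hx e
    cases x <;> simp_all [eq_notMem_alt])
  have hl : ∀ k, (alt k).length = 2 * k := by
    intro k
    induction k with
    | zero => rfl
    | succ k ih => simp [alt, ih]; omega
  have := congrArg List.length hm
  simp only [revSwap, List.length_reverse, List.length_map, hl] at this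
  rw [hm, show m = k by omega]

theorem Core.spread_wrap {v : List Ordering} (h : Core v) (g l : Bool) : Spread (wrap g v l) := by
  obtain ⟨h1, h2, h3⟩ := h
  simp only [Spread, wrap, List.isChain_append]
  refine ⟨by cases g <;> simp, ⟨h1, by cases l <;> simp, ?_⟩, ?_⟩
  · intro x hx y hy
    left
    rintro rfl
    cases l <;> simp at hy
    subst hy
    exact h3 hx
  · intro x hx y hy
    left
    rintro rfl
    cases g <;> simp at hx
    subst hx
    cases v with
    | nil => cases l <;> simp at hy
    | cons z v => exact h2 (by simpa using hy)

theorem Spread.exists_wrap {x : List Ordering} (h : Spread x) :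
    ∃ g v l, Core v ∧ x = wrap g v l := by
  obtain ⟨g, y, hy, hh, rfl⟩ : ∃ (g : Bool) (y : List Ordering), Spread y ∧ y.head? ≠ some .gt ∧
      x = (if g then [.gt] else []) ++ y := by
    by_cases hx : x.head? = some .gt
    · cases x with
      | nil => simp at hx
      | cons z y =>
        simp at hx
        subst hx
        simp only [Spread, List.isChain_cons] at h
        refine ⟨true, y, h.2, ?_, by simp⟩
        intro e
        simpa using h.1 .gt e
    · exact ⟨false, x, h, hx, by simp⟩
  by_cases hl : y.getLast? = some .lt
  · obtain ⟨v, rfl⟩ := List.getLast?_eq_some_iff.1 hl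
    simp only [Spread, List.isChain_append] at hy
    refine ⟨g, v, true, ⟨hy.1, ?_, ?_⟩, by simp [wrap]⟩
    · cases v <;> simp_all
    · intro e
      simpa using hy.2.2 .lt e .lt (by simp)
  · exact ⟨g, y, false, ⟨hy, hh, hl⟩, by simp [wrap]⟩

theorem wrap_injective {g v l g' v' l'} (h : Core v) (h' : Core v')
    (e : wrap g v l = wrap g' v' l') : g = g' ∧ v = v' ∧ l = l' := by
  have key : ∀ {v}, Core v → ∀ g l, ((wrap g v l).head? = some .gt ↔ g = true) ∧
      ((wrap g v l).getLast? = some .lt ↔ l = true) := by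
    intro v h g l
    obtain ⟨h1, h2, h3⟩ := h
    refine ⟨?_, ?_⟩
    · cases g <;> cases l <;> cases v <;> simp_all [wrap]
    · cases l
      · cases g
        · simpa [wrap] using h3
        · cases v with
          | nil => simp [wrap]
          | cons z v => simpa [wrap] using h3
      · cases g <;> simp [wrap, List.getLast?_cons]
  have hg : g = g' := Bool.eq_iff_iff.2 <| by
    rw [← (key h g l).1, ← (key h' g' l').1, e]
  have hl : l = l' := Bool.eq_iff_iff.2 <| by
    rw [← (key h g l).2, ← (key h' g' l').2, e]
  subst hg hl
  simp only [wrap, List.append_cancel_left_eq, List.append_cancel_right_eq] at e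
  exact ⟨rfl, e, rfl⟩

theorem eq_notMem_wrap {g v l} (h : .eq ∉ v) : .eq ∉ wrap g v l := by
  cases g <;> cases l <;> simpa [wrap] using h

theorem ShapeRel.revSwap {s r σ τ} (h : ShapeRel s r σ τ) :
    ShapeRel r s (revSwap τ) (revSwap σ) := by
  have hc : ∀ σ : List Ordering, (_root_.revSwap σ).count .eq = σ.count .eq := by
    intro σ
    rw [_root_.revSwap, List.count_reverse]
    induction σ with
    | nil => rfl
    | cons x σ ih => cases x <;> simp_all
  obtain ⟨rfl, h⟩ | ⟨a, b, g₀, k, l, v, g, l₁, ha, hb, hv, rfl, rfl⟩ := h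
  · exact .inl ⟨rfl, by rw [hc]; omega⟩
  · refine .inr ⟨_root_.revSwap b, _root_.revSwap a, l₁, k, g, _root_.revSwap v, l, g₀, ?_, ?_, core_revSwap.2 hv, ?_, ?_⟩
    · have := hb.map_swap
      rwa [List.map_reverse] at this
    · simpa [_root_.revSwap] using ha.map_swap
    · rw [← List.singleton_append, revSwap_append, revSwap_append, revSwap_append,
        revSwap_append, revSwap_wrap, revSwap_wrap, revSwap_alt]
      simp [_root_.revSwap]
    · rw [← List.singleton_append, revSwap_append, revSwap_append, revSwap_append,
        revSwap_append, revSwap_wrap, revSwap_wrap, revSwap_alt]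
      simp [_root_.revSwap]

theorem ShapeRel.right_unique {s r σ τ τ'} (h : ShapeRel s r σ τ) (h' : ShapeRel s r σ τ') :
    τ = τ' := by
  have key : ∀ {a b : List Ordering} {x y}, EqPrefix s a → EqPrefix r b.reverse →
      ¬ (a ++ ((x ++ Ordering.eq :: y) ++ b)).count Ordering.eq ≤ s + r := by
    intro a b x y ha hb
    have := hb.count
    simp only [List.count_reverse] at this
    simp only [List.count_append, ha.count, this, List.count_cons_self]
    omega
  obtain ⟨rfl, h⟩ | ⟨a, b, g₀, k, l, v, g, l₁, ha, hb, hv, rfl, rfl⟩ := h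
  · obtain ⟨rfl, h'⟩ | ⟨a, b, g₀, k, l, v, g, l₁, ha, hb, hv, rfl, rfl⟩ := h'
    · rfl
    · exact absurd h (key ha hb)
  · obtain ⟨rfl, h'⟩ | ⟨a', b', g₀', k', l', v', g', l₁', ha', hb', hv', e, rfl⟩ := h'
    · exact absurd h' (key ha hb)
    · obtain ⟨rfl, e₁⟩ := ha.append_inj ha' e
      have e₂ := congrArg List.reverse e₁
      rw [List.reverse_append (bs := b), List.reverse_append (bs := b')] at e₂
      obtain ⟨eb, e₃⟩ := hb.append_inj hb' e₂
      rw [List.reverse_inj] at eb e₃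
      subst eb
      have e1 := (EqPrefix.of_not_mem (eq_notMem_wrap (eq_notMem_alt k) (g := g₀) (l := l))).append_inj
        (EqPrefix.of_not_mem (eq_notMem_wrap (eq_notMem_alt k') (g := g₀') (l := l')))
        (y := wrap g v l₁) (y' := wrap g' v' l₁') (by simpa using e₃)
      obtain ⟨e1, e2⟩ := e1
      rw [List.append_cancel_right_eq] at e1
      obtain ⟨rfl, e3, rfl⟩ := wrap_injective (core_alt _) (core_alt _) e1
      obtain ⟨rfl, rfl, rfl⟩ := wrap_injective hv hv' e2
      obtain rfl := alt_injective e3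
      rfl

theorem ShapeRel.left_unique {s r σ σ' τ} (h : ShapeRel s r σ τ) (h' : ShapeRel s r σ' τ) :
    σ = σ' := by
  rw [← revSwap_revSwap σ, ← revSwap_revSwap σ', h.revSwap.right_unique h'.revSwap]

theorem exists_shapeRel {s q r : ℕ} {σ : List Ordering} (hσ : Spread σ)
    (h : ¬ shapePat (s + 1) q r <+ σ) :
    ∃ τ, Spread τ ∧ ¬ shapePat s q (r + 1) <+ τ ∧ ShapeRel s r σ τ := by
  by_cases hc : σ.count .eq ≤ s + r
  · refine ⟨σ, hσ, ?_, .inl ⟨rfl, hc⟩⟩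
    intro hs
    have := hs.count_le .eq
    simp [shapePat, List.count_append] at this
    omega
  obtain ⟨a, y, ha, rfl⟩ := exists_eqPrefix (s := s) (σ := σ) (by omega)
  rw [List.count_append, ha.count] at hc
  obtain ⟨b', y', hb, e⟩ := exists_eqPrefix (s := r) (σ := y.reverse)
    (by rw [List.count_reverse]; omega)
  obtain ⟨b, rfl⟩ : ∃ b, b' = b.reverse := ⟨b'.reverse, by simp⟩
  have hb' := hb.count
  rw [List.count_reverse] at hb'
  obtain rfl : y = y'.reverse ++ b := by
    rw [← List.reverse_reverse y, e]; simp
  rw [List.count_append, hb'] at hc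
  obtain ⟨u, w, e', hu⟩ := List.eq_append_cons_of_mem (a := Ordering.eq) (xs := y'.reverse)
    (List.count_pos_iff.1 (by omega))
  rw [e'] at hσ h ⊢
  have hsp := hσ
  rw [ha.spread_append, hb.spread_append', spread_append_eq_cons] at hsp
  obtain ⟨sa, ⟨su, sw⟩, sb⟩ := hsp
  obtain ⟨g₀, u', l, hu', rfl⟩ := su.exists_wrap
  obtain ⟨g, v, l₁, hv, rfl⟩ := sw.exists_wrap
  obtain ⟨k, rfl⟩ := hu'.exists_alt (by
    intro hm; exact hu (by simp [wrap, hm]))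
  refine ⟨_, ?_, ?_, .inr ⟨a, b, g₀, k, l, v, g, l₁, ha, hb, hv, rfl, rfl⟩⟩
  · rw [ha.spread_append, hb.spread_append', spread_append_eq_cons]
    exact ⟨sa, ⟨hv.spread_wrap _ _, (core_alt k).spread_wrap _ _⟩, sb⟩
  · intro hs
    apply h
    have h1 := ha.sublist_of_append hs
    have hb2 : EqPrefix (r + 1) (.eq :: wrap g (alt k) l₁ ++ b).reverse := by
      have : EqPrefix 1 ((wrap g (alt k) l₁).reverse ++ [.eq]) :=
        EqPrefix.of_not_mem (by simpa using eq_notMem_wrap (eq_notMem_alt k))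
      have := hb.append this
      simpa using this
    have h2 : .lt :: (List.replicate q .eq ++ [.gt]) <+ wrap g₀ v l := by
      rw [← List.reverse_sublist]
      apply hb2.sublist_of_append
      rw [← List.reverse_sublist]
      simpa using h1
    have h3 : .lt :: (List.replicate q .eq ++ [.gt]) <+ v := by
      have h4 : .lt :: (List.replicate q .eq ++ [.gt]) <+ v ++ (if l then [.lt] else []) := by
        cases g₀ with
        | false => simpa [wrap] using h2
        | true =>
          simp only [wrap, if_true, List.singleton_append] at h2
          cases h2 with
          | cons _ h => exact h
      cases l with
      | false => simpa using h4
      | true =>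
        rw [← List.reverse_sublist] at h4 ⊢
        simp only [if_true, List.reverse_append, List.reverse_cons, List.reverse_nil,
          List.nil_append, List.cons_append] at h4 ⊢
        cases h4 with
        | cons _ h => exact h
    have h5 : List.replicate s .eq ++ (([.eq] ++ (.lt :: (List.replicate q .eq ++ [.gt]))) ++
        List.replicate r .eq) <+
        a ++ ((wrap g₀ (alt k) l ++ .eq :: wrap g v l₁) ++ b) := by
      refine ha.replicate_sublist.append (List.Sublist.append ?_ ?_)
      · refine List.Sublist.trans ?_ (List.sublist_append_right _ _)
        simp only [List.singleton_append, List.cons_sublist_cons]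
        refine h3.trans ?_
        refine List.Sublist.trans ?_ (List.sublist_append_right _ _)
        exact List.sublist_append_left _ _
      · rw [← List.reverse_sublist]
        simpa using hb.replicate_sublist
    rw [shapePat, List.replicate_succ', List.append_assoc]
    simpa using h5

theorem shapePat_sublist_revSwap {s q r σ} :
    shapePat s q r <+ revSwap σ ↔ shapePat r q s <+ σ := by
  have hp : ∀ s r, revSwap (shapePat s q r) = shapePat r q s := by
    intro s r
    simp [shapePat, revSwap]
  have hm : ∀ {σ τ}, σ <+ τ → revSwap σ <+ revSwap τ := fun h => (h.map Ordering.swap).reverse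
  exact ⟨fun h => by simpa only [hp, revSwap_revSwap] using hm h,
    fun h => by simpa only [hp] using hm h⟩

theorem exists_shapeRel' {s q r : ℕ} {τ : List Ordering} (hτ : Spread τ)
    (h : ¬ shapePat s q (r + 1) <+ τ) :
    ∃ σ, Spread σ ∧ ¬ shapePat (s + 1) q r <+ σ ∧ ShapeRel s r σ τ := by
  obtain ⟨σ, h1, h2, h3⟩ := exists_shapeRel (s := r) (q := q) (r := s) (spread_revSwap.2 hτ)
    (by rwa [shapePat_sublist_revSwap])
  refine ⟨revSwap σ, spread_revSwap.2 h1, ?_, ?_⟩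
  · rwa [shapePat_sublist_revSwap]
  · simpa [revSwap_revSwap] using h3.revSwap

theorem ShapeRel.eq_or {s r σ τ} (h : ShapeRel (s + 1) r σ τ) :
    σ = τ ∨ ((σ.count .lt = τ.count .lt ∧ σ.count .eq = τ.count .eq ∧
        σ.count .gt = τ.count .gt) ∧
      ∃ u y y', .eq ∉ u ∧ σ = u ++ .eq :: y ∧ τ = u ++ .eq :: y') := by
  obtain ⟨rfl, -⟩ | ⟨a, b, g₀, k, l, v, g, l₁, ha, hb, hv, rfl, rfl⟩ := h
  · exact .inl rfl
  have hw : ∀ g v l x, (wrap g v l).count x = v.count x +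
      (if g then [Ordering.gt] else []).count x + (if l then [Ordering.lt] else []).count x := by
    intro g v l x
    simp only [wrap, List.count_append]
    omega
  refine .inr ⟨⟨?_, ?_, ?_⟩, ?_⟩
  · simp [List.count_append, hw]; omega
  · simp [List.count_append, hw]; omega
  · simp [List.count_append, hw]; omega
  · obtain ⟨u, y, hu, rfl⟩ := ha.exists_first
    exact ⟨u, y ++ (wrap g₀ (alt k) l ++ .eq :: wrap g v l₁ ++ b),
      y ++ (wrap g₀ v l ++ .eq :: wrap g (alt k) l₁ ++ b), hu, by simp, by simp⟩

/-- `Fill P Q b σ As Bs π`: the word `π` arises from the shape `σ` by replacing the successive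
occurrences of `lt` (`gt`) by the nonempty blocks in `As` (`Bs`), whose letters satisfy
`P` (`Q`), and those of `eq` by `b`. -/
inductive Fill (P Q : ℕ → Prop) (b : ℕ) :
    List Ordering → List (List ℕ) → List (List ℕ) → List ℕ → Prop
  | nil : Fill P Q b [] [] [] []
  | eq {σ As Bs π} : Fill P Q b σ As Bs π → Fill P Q b (.eq :: σ) As Bs (b :: π)
  | lt {σ A As Bs π} : A ≠ [] → (∀ x ∈ A, P x) → σ.head? ≠ some .lt → Fill P Q b σ As Bs π →
      Fill P Q b (.lt :: σ) (A :: As) Bs (A ++ π)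
  | gt {σ As B Bs π} : B ≠ [] → (∀ x ∈ B, Q x) → σ.head? ≠ some .gt → Fill P Q b σ As Bs π →
      Fill P Q b (.gt :: σ) As (B :: Bs) (B ++ π)

section Fill

variable {P Q : ℕ → Prop} {b : ℕ} {σ τ : List Ordering} {As Bs : List (List ℕ)} {π π' : List ℕ}

theorem Fill.swap (h : Fill P Q b σ As Bs π) : Fill Q P b (σ.map Ordering.swap) Bs As π := by
  induction h with
  | nil => exact .nil
  | eq _ ih => exact .eq ih
  | @lt σ A As Bs π h1 h2 h3 _ ih =>
    refine .gt h1 h2 ?_ ih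
    cases σ with
    | nil => simp
    | cons z σ => cases z <;> simp_all
  | @gt σ A As Bs π h1 h2 h3 _ ih =>
    refine .lt h1 h2 ?_ ih
    cases σ with
    | nil => simp
    | cons z σ => cases z <;> simp_all

theorem Fill.spread (h : Fill P Q b σ As Bs π) : Spread σ := by
  induction h with
  | nil => simp [Spread]
  | eq _ ih => exact List.isChain_cons.2 ⟨fun y _ => by cases y <;> simp, ih⟩
  | lt _ _ h _ ih => exact List.isChain_cons.2 ⟨fun y hy => .inl (by rintro rfl; exact h hy), ih⟩
  | gt _ _ h _ ih => exact List.isChain_cons.2 ⟨fun y hy => .inl (by rintro rfl; exact h hy), ih⟩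

theorem Fill.count_lt (h : Fill P Q b σ As Bs π) : σ.count .lt = As.length := by
  induction h <;> simp_all

theorem Fill.count_gt (h : Fill P Q b σ As Bs π) : σ.count .gt = Bs.length := by
  induction h <;> simp_all

theorem Fill.blocks_lt (h : Fill P Q b σ As Bs π) : ∀ A ∈ As, A ≠ [] ∧ ∀ x ∈ A, P x := by
  induction h with
  | nil => simp
  | eq _ ih => exact ih
  | lt h1 h2 _ _ ih => exact List.forall_mem_cons.2 ⟨⟨h1, h2⟩, ih⟩
  | gt _ _ _ _ ih => exact ih

theorem Fill.blocks_gt (h : Fill P Q b σ As Bs π) : ∀ B ∈ Bs, B ≠ [] ∧ ∀ x ∈ B, Q x :=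
  h.swap.blocks_lt

theorem exists_fill_of_shape (hs : Spread σ) (hl : σ.count .lt = As.length)
    (hg : σ.count .gt = Bs.length) (hA : ∀ A ∈ As, A ≠ [] ∧ ∀ x ∈ A, P x)
    (hB : ∀ B ∈ Bs, B ≠ [] ∧ ∀ x ∈ B, Q x) : ∃ π, Fill P Q b σ As Bs π := by
  induction σ generalizing As Bs with
  | nil =>
    obtain rfl : As = [] := List.length_eq_zero_iff.1 (by simpa using hl.symm)
    obtain rfl : Bs = [] := List.length_eq_zero_iff.1 (by simpa using hg.symm)
    exact ⟨_, .nil⟩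
  | cons z σ ih =>
    obtain ⟨hz, hs'⟩ := List.isChain_cons.1 hs
    cases z with
    | eq =>
      obtain ⟨π, h⟩ := ih hs' (by simpa using hl) (by simpa using hg) hA hB
      exact ⟨_, .eq h⟩
    | lt =>
      cases As with
      | nil => simp at hl
      | cons A As =>
        obtain ⟨π, h⟩ := ih hs' (by simpa using hl) (by simpa using hg)
          (fun A' h => hA A' (by simp [h])) hB
        exact ⟨_, .lt (hA A (by simp)).1 (hA A (by simp)).2
          (fun e => by simpa using hz _ e) h⟩
    | gt =>
      cases Bs with
      | nil => simp at hg
      | cons B Bs =>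
        obtain ⟨π, h⟩ := ih hs' (by simpa using hl) (by simpa using hg) hA
          (fun A' h => hB A' (by simp [h]))
        exact ⟨_, .gt (hB B (by simp)).1 (hB B (by simp)).2
          (fun e => by simpa using hz _ e) h⟩

theorem Fill.functional (h : Fill P Q b σ As Bs π) (h' : Fill P Q b σ As Bs π') : π = π' := by
  induction h generalizing π' with
  | nil => cases h'; rfl
  | eq _ ih => cases h' with | eq h' => rw [ih h']
  | lt _ _ _ _ ih => cases h' with | lt _ _ _ h' => rw [ih h']
  | gt _ _ _ _ ih => cases h' with | gt _ _ _ h' => rw [ih h']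

theorem Fill.length (h : Fill P Q b σ As Bs π) :
    π.length = σ.count .eq + As.flatten.length + Bs.flatten.length := by
  induction h with
  | nil => rfl
  | eq _ ih => simp only [List.length_cons, ih, List.count_cons_self]; omega
  | lt _ _ _ _ ih => simp [ih]; omega
  | gt _ _ _ _ ih => simp [ih]; omega

theorem Fill.filter_eq [DecidablePred P] (h : Fill P Q b σ As Bs π) (hb : ¬ P b)
    (hQ : ∀ x, Q x → ¬ P x) : π.filter P = As.flatten := by
  induction h with
  | nil => rfl
  | eq _ ih => simpa [hb] using ih
  | lt _ h _ _ ih =>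
    rw [List.filter_append, ih, List.flatten_cons, List.filter_eq_self.2 (by simpa using h)]
  | gt _ h _ _ ih =>
    rw [List.filter_append, ih, List.filter_eq_nil_iff.2 (fun x hx => by simpa using hQ x (h x hx))]
    simp

theorem Fill.common_prefix {u y y' : List Ordering} (hu : .eq ∉ u) (hP : ∀ x, P x → x ≠ b)
    (hQ : ∀ x, Q x → x ≠ b) (h : Fill P Q b (u ++ .eq :: y) As Bs π)
    (h' : Fill P Q b (u ++ .eq :: y') As Bs π') :
    ∃ l m m', b ∉ l ∧ π = l ++ b :: m ∧ π' = l ++ b :: m' := by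
  induction u generalizing As Bs π π' with
  | nil =>
    cases h with | eq h =>
    cases h' with | eq h' =>
    exact ⟨[], _, _, by simp, rfl, rfl⟩
  | cons z u ih =>
    cases z with
    | eq => simp at hu
    | lt =>
      cases h with | lt _ hA _ h =>
      cases h' with | lt _ _ _ h' =>
      obtain ⟨l, m, m', h1, rfl, rfl⟩ := ih (by simpa using hu) h h'
      refine ⟨_ ++ l, m, m', ?_, (List.append_assoc ..).symm, (List.append_assoc ..).symm⟩
      rw [List.mem_append, not_or]
      exact ⟨fun hb => hP _ (hA _ hb) rfl, h1⟩
    | gt =>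
      cases h with | gt _ hA _ h =>
      cases h' with | gt _ _ _ h' =>
      obtain ⟨l, m, m', h1, rfl, rfl⟩ := ih (by simpa using hu) h h'
      refine ⟨_ ++ l, m, m', ?_, (List.append_assoc ..).symm, (List.append_assoc ..).symm⟩
      rw [List.mem_append, not_or]
      exact ⟨fun hb => hQ _ (hA _ hb) rfl, h1⟩

end Fill

/-- The decomposition of a word into maximal blocks of letters below and above `b`. -/
abbrev CmpFill (b : ℕ) := Fill (· < b) (b < ·) b

theorem exists_cmpFill (b : ℕ) (π : List ℕ) : ∃ σ As Bs, CmpFill b σ As Bs π := by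
  induction π with
  | nil => exact ⟨_, _, _, .nil⟩
  | cons x π ih =>
    obtain ⟨σ, As, Bs, h⟩ := ih
    obtain hx | rfl | hx := lt_trichotomy x b
    · by_cases hs : σ.head? = some .lt
      · cases h with
        | nil => simp at hs
        | eq h => simp at hs
        | gt _ _ _ h => simp at hs
        | lt h1 h2 h3 h =>
          exact ⟨_, _, _, .lt (A := x :: _) (by simp) (List.forall_mem_cons.2 ⟨hx, h2⟩) h3 h⟩
      · exact ⟨_, _, _, .lt (A := [x]) (by simp) (by simpa) hs h⟩
    · exact ⟨_, _, _, .eq h⟩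
    · by_cases hs : σ.head? = some .gt
      · cases h with
        | nil => simp at hs
        | eq h => simp at hs
        | lt _ _ _ h => simp at hs
        | gt h1 h2 h3 h =>
          exact ⟨_, _, _, .gt (B := x :: _) (by simp) (List.forall_mem_cons.2 ⟨hx, h2⟩) h3 h⟩
      · exact ⟨_, _, _, .gt (B := [x]) (by simp) (by simpa) hs h⟩

theorem CmpFill.head?_shape {b σ As Bs π} (h : CmpFill b σ As Bs π) :
    σ.head? = π.head?.map (compare · b) := by
  cases h with
  | nil => rfl
  | eq _ => simp
  | @lt _ A _ _ _ h1 h2 _ _ =>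
    cases A with
    | nil => simp at h1
    | cons x A => simp [compare_lt_iff_lt.2 (h2 x (by simp))]
  | @gt _ _ A _ _ h1 h2 _ _ =>
    cases A with
    | nil => simp at h1
    | cons x A => simp [compare_gt_iff_gt.2 (h2 x (by simp))]

theorem append_inj_of_forall {P : ℕ → Prop} {A A' R R' : List ℕ} (hA : ∀ x ∈ A, P x)
    (hA' : ∀ x ∈ A', P x) (hR : ∀ x ∈ R.head?, ¬ P x) (hR' : ∀ x ∈ R'.head?, ¬ P x)
    (e : A ++ R = A' ++ R') : A = A' ∧ R = R' := by
  induction A generalizing A' with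
  | nil =>
    cases A' with
    | nil => exact ⟨rfl, e⟩
    | cons x A' =>
      simp only [List.nil_append] at e
      subst e
      exact absurd (hA' x (by simp)) (hR x (by simp))
  | cons x A ih =>
    cases A' with
    | nil =>
      simp only [List.nil_append] at e
      subst e
      exact absurd (hA x (by simp)) (hR' x (by simp))
    | cons x' A' =>
      simp only [List.cons_append, List.cons.injEq] at e
      obtain ⟨rfl, rfl⟩ := ih (fun z hz => hA z (by simp [hz])) (fun z hz => hA' z (by simp [hz])) e.2
      simp [e.1]

theorem CmpFill.unique {b σ As Bs σ' As' Bs' π} (h : CmpFill b σ As Bs π)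
    (h' : CmpFill b σ' As' Bs' π) : σ = σ' ∧ As = As' ∧ Bs = Bs' := by
  have hlt : ∀ {σ As Bs π}, CmpFill b σ As Bs π → σ.head? ≠ some .lt →
      ∀ x ∈ π.head?, ¬ x < b := by
    intro σ As Bs π h hs x hx hlt
    rw [h.head?_shape, Option.mem_def.1 hx] at hs
    simp [compare_lt_iff_lt.2 hlt] at hs
  have hgt : ∀ {σ As Bs π}, CmpFill b σ As Bs π → σ.head? ≠ some .gt →
      ∀ x ∈ π.head?, ¬ b < x := by
    intro σ As Bs π h hs x hx hlt
    rw [h.head?_shape, Option.mem_def.1 hx] at hs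
    simp [compare_gt_iff_gt.2 hlt] at hs
  generalize hπ : π = ρ at h'
  induction h generalizing σ' As' Bs' ρ with
  | nil =>
    subst hπ
    generalize hρ : ([] : List ℕ) = ρ at h'
    cases h' with
    | nil => simp
    | eq => cases hρ
    | lt h => exact absurd hρ.symm (by simp [h])
    | gt h => exact absurd hρ.symm (by simp [h])
  | eq h ih =>
    have hh := h'.head?_shape
    subst hπ
    generalize hρ : _ :: _ = ρ at h'
    cases h' <;> simp at hh
    rename_i h2
    obtain ⟨rfl, rfl, rfl⟩ := ih _ (List.cons.inj hρ).2 h2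
    simp
  | lt hA0 hA hs h ih =>
    have hh := h'.head?_shape
    rw [← hπ, ← CmpFill.head?_shape (.lt hA0 hA hs h)] at hh
    cases h' <;> simp at hh
    rename_i hA' hs' h'
    obtain ⟨rfl, e⟩ := append_inj_of_forall hA hA' (hlt h hs) (hlt h' hs') hπ
    obtain ⟨rfl, rfl, rfl⟩ := ih _ e h'
    simp
  | gt hA0 hA hs h ih =>
    have hh := h'.head?_shape
    rw [← hπ, ← CmpFill.head?_shape (.gt hA0 hA hs h)] at hh
    cases h' <;> simp at hh
    rename_i hA' hs' h'
    obtain ⟨rfl, e⟩ := append_inj_of_forall hA hA' (hgt h hs) (hgt h' hs') hπ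
    obtain ⟨rfl, rfl, rfl⟩ := ih _ e h'
    simp

/-- `π` contains a subsequence `c^s x c^q y c^r` with `x < c < y`. -/
def HasShapeAt (c s q r : ℕ) (π : List ℕ) : Prop := shapePat s q r <+ π.map (compare · c)

theorem spread_shapePat (s q r : ℕ) : Spread (shapePat s q r) := by
  have h : ∀ (n : ℕ) (l : List Ordering), Spread l → Spread (List.replicate n .eq ++ l) := by
    intro n l hl
    induction n with
    | zero => exact hl
    | succ n ih => exact List.isChain_cons.2 ⟨fun y _ => by cases y <;> simp, ih⟩
  refine h _ _ (List.isChain_cons.2 ⟨?_, h _ _ (List.isChain_cons.2 ⟨?_, ?_⟩)⟩)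
  · cases q <;> simp [List.replicate_succ]
  · cases r <;> simp [List.replicate_succ]
  · have := h r [] (by simp [Spread])
    rwa [List.append_nil] at this

theorem Spread.append_right {σ τ : List Ordering} (h : Spread (σ ++ τ)) : Spread τ :=
  List.IsChain.right_of_append h

theorem Spread.replicate_le_one {n : ℕ} {z : Ordering} {τ : List Ordering} (hz : z ≠ .eq)
    (h : Spread (List.replicate n z ++ τ)) : n ≤ 1 := by
  match n with
  | 0 | 1 => simp
  | n + 2 =>
    have := (List.isChain_cons.1 h).1 z (by simp [List.replicate_succ])
    simp_all

theorem sublist_cons_of_sublist_map {z : Ordering} (hz : z ≠ .eq) {f : ℕ → Ordering} {A : List ℕ}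
    (hA : ∀ x ∈ A, f x = z) {τ w σ : List Ordering} (hτ : Spread τ) (h : τ <+ A.map f ++ w)
    (ih : ∀ {τ}, Spread τ → τ <+ w → τ <+ σ) : τ <+ z :: σ := by
  obtain ⟨τ₁, τ₂, rfl, h1, h2⟩ := List.sublist_append_iff.1 h
  obtain ⟨n, -, rfl⟩ : ∃ n ≤ A.length, τ₁ = List.replicate n z := by
    rw [← List.sublist_replicate_iff]
    rwa [List.map_congr_left hA, List.map_const'] at h1
  have h3 := ih hτ.append_right h2
  have hn := hτ.replicate_le_one hz
  interval_cases n
  · exact h3.cons _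
  · exact h3.cons_cons _

theorem CmpFill.sublist_iff {b σ As Bs π} (h : CmpFill b σ As Bs π) {τ : List Ordering}
    (hτ : Spread τ) : τ <+ π.map (compare · b) ↔ τ <+ σ := by
  refine ⟨fun hs => ?_, fun hs => hs.trans ?_⟩
  swap
  · clear hs
    induction h with
    | nil => simp
    | eq _ ih => simpa using ih
    | @lt σ A As Bs π h1 h2 _ _ ih =>
      cases A with
      | nil => simp at h1
      | cons x A =>
        rw [List.cons_append, List.map_cons, compare_lt_iff_lt.2 (h2 x (by simp)),
          List.map_append]
        exact (ih.trans (List.sublist_append_right _ _)).cons_cons _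
    | @gt σ As A Bs π h1 h2 _ _ ih =>
      cases A with
      | nil => simp at h1
      | cons x A =>
        rw [List.cons_append, List.map_cons, compare_gt_iff_gt.2 (h2 x (by simp)),
          List.map_append]
        exact (ih.trans (List.sublist_append_right _ _)).cons_cons _
  · induction h generalizing τ with
    | nil => simp_all
    | eq _ ih =>
      rw [List.map_cons, compare_eq_iff_eq.2 rfl] at hs
      obtain h' | ⟨τ', rfl, h'⟩ := List.sublist_cons_iff.1 hs
      · exact (ih hτ h').cons _
      · exact (ih (List.isChain_cons.1 hτ).2 h').cons_cons _
    | lt _ h2 _ _ ih =>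
      rw [List.map_append] at hs
      exact sublist_cons_of_sublist_map (by simp) (fun x hx => compare_lt_iff_lt.2 (h2 x hx)) hτ hs
        (fun h => ih h)
    | gt _ h2 _ _ ih =>
      rw [List.map_append] at hs
      exact sublist_cons_of_sublist_map (by simp) (fun x hx => compare_gt_iff_gt.2 (h2 x hx)) hτ hs
        (fun h => ih h)

theorem sublist_of_sublist_cons {z : Ordering} {τ w : List Ordering} (hτ : τ.head? ≠ some z)
    (h : τ <+ z :: w) : τ <+ w := by
  obtain h | ⟨τ', rfl, h⟩ := List.sublist_cons_iff.1 h
  · exact h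
  · simp at hτ

/-- If `f` is constantly `z` on the letters other than those in the blocks `As`, then whether a
word without adjacent `z` embeds into the image of `π` only depends on `As`. -/
theorem Fill.sublist_map_iff {P Q : ℕ → Prop} {b σ As Bs π} (h : Fill P Q b σ As Bs π)
    {f : ℕ → Ordering} {z : Ordering} (hz : z ≠ .eq) (hb : f b = z) (hQ : ∀ x, Q x → f x = z)
    {τ : List Ordering} (hτ : Spread τ) (hh : τ.head? ≠ some z) (hl : τ.getLast? ≠ some z) :
    τ <+ π.map f ↔ τ <+ As.flatMap (fun A => A.map f ++ [z]) := by
  induction h generalizing τ with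
  | nil => simp
  | eq _ ih =>
    rw [← ih hτ hh hl, List.map_cons, hb]
    exact ⟨sublist_of_sublist_cons hh, fun h => h.cons _⟩
  | @gt _ _ B _ _ _ h2 _ _ ih =>
    rw [← ih hτ hh hl, List.map_append, List.map_congr_left (fun x hx => hQ x (h2 x hx)),
      List.map_const']
    generalize B.length = n
    induction n with
    | zero => simp
    | succ n ih' =>
      rw [← ih', List.replicate_succ, List.cons_append]
      exact ⟨sublist_of_sublist_cons hh, fun h => h.cons _⟩
  | @lt σ A As Bs π _ _ h3 h ih =>
    have hd : ∀ {τ : List Ordering}, Spread (z :: τ) → τ.head? ≠ some z := fun h e => by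
      have := (List.isChain_cons.1 h).1 z e
      simp_all
    rw [List.flatMap_cons, List.append_assoc, List.map_append, List.sublist_append_iff,
      List.sublist_append_iff]
    refine exists_congr fun τ₁ => exists_congr fun τ₂ => and_congr_right ?_
    rintro rfl
    refine and_congr_right fun _ => ?_
    have h4 := hτ.append_right
    by_cases h5 : τ₂.head? = some z
    · obtain ⟨τ₃, rfl⟩ : ∃ t, τ₂ = z :: t := by
        cases τ₂ <;> simp_all
      have h6 := hd h4
      have h7 := (List.isChain_cons.1 h4).2
      have h8 : τ₃.getLast? ≠ some z := by
        cases τ₃ <;> simp_all [List.getLast?_append, List.getLast?_cons]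
      have h9 : τ₃ ≠ [] := by
        rintro rfl
        simp at hl
      rw [List.singleton_append, List.cons_sublist_cons, ← ih h7 h6 h8]
      refine ⟨fun h => (List.sublist_cons_self _ _).trans h, fun h' => ?_⟩
      obtain ⟨x, π', rfl, hx⟩ : ∃ x π', π = x :: π' ∧ f x = z := by
        cases h with
        | nil => simp_all
        | eq _ => exact ⟨_, _, rfl, hb⟩
        | lt => simp at h3
        | @gt _ _ B _ _ hB1 hB2 _ _ =>
          cases B with
          | nil => simp at hB1
          | cons x B => exact ⟨_, _, rfl, hQ _ (hB2 x (by simp))⟩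
      rw [List.map_cons, hx] at h' ⊢
      exact (sublist_of_sublist_cons h6 h').cons_cons _
    · have h8 : τ₂.getLast? ≠ some z := by
        cases τ₂ <;> simp_all [List.getLast?_append, List.getLast?_cons]
      rw [ih h4 h5 h8, List.singleton_append]
      exact ⟨fun h => h.cons _, sublist_of_sublist_cons h5⟩

/-- Two words arising from shapes with the same letters, and with the same letters before the
first `eq`, by filling in the same blocks. -/
def Twin (b : ℕ) (π π' : List ℕ) : Prop :=
  ∃ σ σ' As Bs u y y', CmpFill b σ As Bs π ∧ CmpFill b σ' As Bs π' ∧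
    σ.count .eq = σ'.count .eq ∧ .eq ∉ u ∧ σ = u ++ .eq :: y ∧ σ' = u ++ .eq :: y'

/-- Every occurrence of `c + 1` is preceded by one of `c`. -/
def Preceded (c : ℕ) (π : List ℕ) : Prop := ∀ l₁ l₂, π = l₁ ++ (c + 1) :: l₂ → c ∈ l₁

theorem preceded_filter {P : ℕ → Prop} [DecidablePred P] {c : ℕ} (h : P c) (h' : P (c + 1))
    {π : List ℕ} : Preceded c (π.filter P) ↔ Preceded c π := by
  constructor
  · rintro H l₁ l₂ rfl
    have := H (l₁.filter P) (l₂.filter P) (by simp [h'])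
    exact (List.mem_filter.1 this).1
  · intro H l₁ l₂ e
    obtain ⟨m₁, m₂, rfl, rfl, e2⟩ := List.filter_eq_append_iff.1 e
    obtain ⟨k, k', rfl, hk, -, -⟩ := List.filter_eq_cons_iff.1 e2
    have := H (m₁ ++ k) k' (by simp)
    obtain h1 | h1 := List.mem_append.1 this
    · exact List.mem_filter.2 ⟨h1, by simpa using h⟩
    · exact absurd h (by simpa using hk c h1)

theorem preceded_iff_mem {c : ℕ} {l m : List ℕ} (hl : c + 1 ∉ l) :
    Preceded c (l ++ (c + 1) :: m) ↔ c ∈ l := by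
  refine ⟨fun H => H _ _ rfl, fun h l₁ l₂ e => ?_⟩
  obtain ⟨a, rfl, -⟩ | ⟨a, rfl, e'⟩ := List.append_eq_append_iff.1 e
  · simp [h]
  · cases a with
    | nil => simpa using h
    | cons z a =>
      simp only [List.cons_append, List.cons.injEq] at e'
      simp [← e'.1] at hl

theorem preceded_iff_notMem {c : ℕ} {l m : List ℕ} (hl : c ∉ l) :
    Preceded c (l ++ c :: m) ↔ c + 1 ∉ l := by
  constructor
  · intro H h
    obtain ⟨x, y, rfl⟩ := List.append_of_mem h
    have := H x (y ++ c :: m) (by simp)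
    simp [this] at hl
  · intro h l₁ l₂ e
    obtain ⟨a, rfl, e'⟩ | ⟨a, rfl, e'⟩ := List.append_eq_append_iff.1 e
    · cases a with
      | nil => simp at e'
      | cons z a =>
        simp only [List.cons_append, List.cons.injEq] at e'
        simp [← e'.1]
    · cases a with
      | nil => simp at e'
      | cons z a =>
        simp only [List.cons_append, List.cons.injEq] at e'
        simp [← e'.1] at h

section Twin

variable {b : ℕ} {π π' : List ℕ}

theorem Twin.length (h : Twin b π π') : π.length = π'.length := by
  obtain ⟨σ, σ', As, Bs, u, y, y', h, h', hc, -⟩ := h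
  rw [h.length, h'.length, hc]

theorem Twin.filter_lt (h : Twin b π π') : π.filter (· < b) = π'.filter (· < b) := by
  obtain ⟨σ, σ', As, Bs, u, y, y', h, h', -⟩ := h
  rw [h.filter_eq (by simp) (by omega), h'.filter_eq (by simp) (by omega)]

theorem Twin.filter_gt (h : Twin b π π') : π.filter (b < ·) = π'.filter (b < ·) := by
  obtain ⟨σ, σ', As, Bs, u, y, y', h, h', -⟩ := h
  rw [h.swap.filter_eq (by simp) (by omega), h'.swap.filter_eq (by simp) (by omega)]

theorem Twin.common_prefix (h : Twin b π π') :
    ∃ l m m', b ∉ l ∧ π = l ++ b :: m ∧ π' = l ++ b :: m' := by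
  obtain ⟨σ, σ', As, Bs, u, y, y', h, h', -, hu, rfl, rfl⟩ := h
  exact h.common_prefix hu (by omega) (by omega) h'

theorem Twin.preceded (h : Twin b π π') (c : ℕ) : Preceded c π ↔ Preceded c π' := by
  obtain hc | rfl | rfl | hc : c + 1 < b ∨ c + 1 = b ∨ c = b ∨ b < c := by omega
  · rw [← preceded_filter (P := (· < b)) (by omega) hc, h.filter_lt,
      preceded_filter (P := (· < b)) (by omega) hc]
  · obtain ⟨l, m, m', hl, rfl, rfl⟩ := h.common_prefix
    rw [preceded_iff_mem hl, preceded_iff_mem hl]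
  · obtain ⟨l, m, m', hl, rfl, rfl⟩ := h.common_prefix
    rw [preceded_iff_notMem hl, preceded_iff_notMem hl]
  · rw [← preceded_filter (P := (b < ·)) hc (by omega), h.filter_gt,
      preceded_filter (P := (b < ·)) hc (by omega)]

theorem Twin.zero_mem (h : Twin b π π') (hb : 0 < b) : 0 ∈ π ↔ 0 ∈ π' := by
  have h1 : ∀ π : List ℕ, 0 ∈ π ↔ 0 ∈ π.filter (· < b) := by simp [hb]
  rw [h1, h.filter_lt, ← h1]

theorem getLast?_shapePat_ne_lt (s q r : ℕ) : (shapePat s q r).getLast? ≠ some .lt := by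
  simp [shapePat, List.getLast?_append, List.getLast?_cons]
  cases r <;> simp [List.getLast?_replicate]

theorem getLast?_shapePat_succ (s q r : ℕ) : (shapePat s q (r + 1)).getLast? = some .eq := by
  simp [shapePat, List.getLast?_append, List.getLast?_cons, List.getLast?_replicate]

theorem Twin.hasShapeAt_of_lt (h : Twin b π π') {c s q r : ℕ} (hc : c < b) :
    HasShapeAt c (s + 1) q (r + 1) π ↔ HasShapeAt c (s + 1) q (r + 1) π' := by
  obtain ⟨σ, σ', As, Bs, u, y, y', h, h', -⟩ := h
  have : ∀ {σ π}, CmpFill b σ As Bs π → (HasShapeAt c (s + 1) q (r + 1) π ↔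
      shapePat (s + 1) q (r + 1) <+ As.flatMap (fun A => A.map (compare · c) ++ [.gt])) :=
    fun h => h.sublist_map_iff (f := (compare · c)) (by simp) (compare_gt_iff_gt.2 hc)
      (fun x hx => compare_gt_iff_gt.2 (hc.trans hx)) (spread_shapePat _ _ _)
      (by simp [shapePat, List.replicate_succ]) (by simp [getLast?_shapePat_succ])
  rw [this h, this h']

theorem Twin.hasShapeAt_of_gt (h : Twin b π π') {c s q r : ℕ} (hc : b < c) :
    HasShapeAt c (s + 1) q r π ↔ HasShapeAt c (s + 1) q r π' := by
  obtain ⟨σ, σ', As, Bs, u, y, y', h, h', -⟩ := h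
  have : ∀ {σ π}, CmpFill b σ As Bs π → (HasShapeAt c (s + 1) q r π ↔
      shapePat (s + 1) q r <+ Bs.flatMap (fun A => A.map (compare · c) ++ [.lt])) :=
    fun h => h.swap.sublist_map_iff (f := (compare · c)) (by simp) (compare_lt_iff_lt.2 hc)
      (fun x hx => compare_lt_iff_lt.2 (hx.trans hc)) (spread_shapePat _ _ _)
      (by simp [shapePat, List.replicate_succ]) (getLast?_shapePat_ne_lt _ _ _)
  rw [this h, this h']

end Twin

/-- The correspondence between words induced by `ShapeRel` on their shapes. -/
def WordRel (b s r : ℕ) (π π' : List ℕ) : Prop :=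
  ∃ σ σ' As Bs, CmpFill b σ As Bs π ∧ CmpFill b σ' As Bs π' ∧ ShapeRel (s + 1) r σ σ'

theorem WordRel.eq_or_twin {b s r π π'} (h : WordRel b s r π π') : π = π' ∨ Twin b π π' := by
  obtain ⟨σ, σ', As, Bs, h, h', H⟩ := h
  obtain rfl | ⟨⟨-, hc, -⟩, u, y, y', hu, e, e'⟩ := H.eq_or
  · exact .inl (h.functional h')
  · exact .inr ⟨σ, σ', As, Bs, u, y, y', h, h', hc, hu, e, e'⟩

theorem WordRel.right_unique {b s r π π' π''} (h : WordRel b s r π π')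
    (h' : WordRel b s r π π'') : π' = π'' := by
  obtain ⟨σ, σ', As, Bs, h1, h2, H⟩ := h
  obtain ⟨τ, τ', As', Bs', h1', h2', H'⟩ := h'
  obtain ⟨rfl, rfl, rfl⟩ := h1.unique h1'
  obtain rfl := H.right_unique H'
  exact h2.functional h2'

theorem WordRel.left_unique {b s r π π' π''} (h : WordRel b s r π' π)
    (h' : WordRel b s r π'' π) : π' = π'' := by
  obtain ⟨σ, σ', As, Bs, h1, h2, H⟩ := h
  obtain ⟨τ, τ', As', Bs', h1', h2', H'⟩ := h'
  obtain ⟨rfl, rfl, rfl⟩ := h2.unique h2'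
  obtain rfl := H.left_unique H'
  exact h1.functional h1'

theorem ShapeRel.count_eq {s r σ τ} (h : ShapeRel (s + 1) r σ τ) :
    σ.count .lt = τ.count .lt ∧ σ.count .gt = τ.count .gt := by
  obtain rfl | ⟨⟨h1, -, h2⟩, -⟩ := h.eq_or
  · simp
  · exact ⟨h1, h2⟩

theorem exists_wordRel {b s q r : ℕ} {π : List ℕ} (h : ¬ HasShapeAt b (s + 2) q r π) :
    ∃ π', ¬ HasShapeAt b (s + 1) q (r + 1) π' ∧ WordRel b s r π π' := by
  obtain ⟨σ, As, Bs, hf⟩ := exists_cmpFill b π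
  rw [HasShapeAt, hf.sublist_iff (spread_shapePat _ _ _)] at h
  obtain ⟨τ, h1, h2, h3⟩ := exists_shapeRel hf.spread h
  obtain ⟨π', hf'⟩ := exists_fill_of_shape h1 (h3.count_eq.1.symm.trans hf.count_lt)
    (h3.count_eq.2.symm.trans hf.count_gt) hf.blocks_lt hf.blocks_gt
  exact ⟨π', by rwa [HasShapeAt, CmpFill.sublist_iff hf' (spread_shapePat _ _ _)],
    σ, τ, As, Bs, hf, hf', h3⟩

theorem exists_wordRel' {b s q r : ℕ} {π : List ℕ} (h : ¬ HasShapeAt b (s + 1) q (r + 1) π) :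
    ∃ π', ¬ HasShapeAt b (s + 2) q r π' ∧ WordRel b s r π' π := by
  obtain ⟨σ, As, Bs, hf⟩ := exists_cmpFill b π
  rw [HasShapeAt, hf.sublist_iff (spread_shapePat _ _ _)] at h
  obtain ⟨τ, h1, h2, h3⟩ := exists_shapeRel' hf.spread h
  obtain ⟨π', hf'⟩ := exists_fill_of_shape h1 (h3.count_eq.1.trans hf.count_lt)
    (h3.count_eq.2.trans hf.count_gt) hf.blocks_lt hf.blocks_gt
  exact ⟨π', by rwa [HasShapeAt, CmpFill.sublist_iff hf' (spread_shapePat _ _ _)],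
    τ, σ, As, Bs, hf', hf, h3⟩

theorem isCanonicalSeq_concat {π : List ℕ} {x : ℕ} : IsCanonicalSeq (π ++ [x]) ↔
    IsCanonicalSeq π ∧ 1 ≤ x ∧ x ≤ π.foldr max 0 + 1 := by
  constructor
  · intro h
    refine ⟨fun i hi => ?_, ?_⟩
    · have := h i (by simp; omega)
      simpa [List.getElem_append_left hi, List.take_append_of_le_length hi.le] using this
    · simpa using h π.length (by simp)
  · rintro ⟨h, hx⟩ i hi
    rcases Nat.lt_or_ge i π.length with hi' | hi'
    · simpa [List.getElem_append_left hi', List.take_append_of_le_length hi'.le] using h i hi'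
    · obtain rfl : i = π.length := by simp at hi; omega
      simpa using hx

theorem foldr_max_concat (π : List ℕ) (x : ℕ) :
    (π ++ [x]).foldr max 0 = max (π.foldr max 0) x := by
  induction π with
  | nil => simp
  | cons z π ih => simp only [List.cons_append, List.foldr_cons, ih, max_assoc]

theorem IsCanonicalSeq.mem_of_le {π : List ℕ} (h : IsCanonicalSeq π) :
    (∀ c, 1 ≤ c → c ≤ π.foldr max 0 → c ∈ π) ∧ π.foldr max 0 ≤ π.length := by
  induction π using List.reverseRecOn with
  | nil => simp; omega
  | append_singleton π x ih =>
    obtain ⟨h1, h2, h3⟩ := isCanonicalSeq_concat.1 h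
    obtain ⟨ih1, ih2⟩ := ih h1
    rw [foldr_max_concat]
    refine ⟨fun c hc hc' => ?_, by simp; omega⟩
    by_cases hcx : c = x
    · simp [hcx]
    · exact List.mem_append_left _ (ih1 c hc (by omega))

theorem le_foldr_max {π : List ℕ} {x : ℕ} (h : x ∈ π) : x ≤ π.foldr max 0 := by
  induction π with
  | nil => simp at h
  | cons z π ih =>
    rw [List.foldr_cons]
    obtain rfl | h := List.mem_cons.1 h
    · exact le_max_left _ _
    · exact (ih h).trans (le_max_right _ _)

theorem preceded_concat {c x : ℕ} {π : List ℕ} :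
    Preceded c (π ++ [x]) ↔ Preceded c π ∧ (x = c + 1 → c ∈ π) := by
  constructor
  · refine fun h => ⟨?_, ?_⟩
    · rintro l₁ l₂ rfl
      exact h l₁ (l₂ ++ [x]) (by simp)
    · rintro rfl
      exact h π [] rfl
  · rintro ⟨h1, h2⟩ l₁ l₂ e
    obtain rfl | ⟨l, z, rfl⟩ := List.eq_nil_or_concat l₂
    · obtain ⟨rfl, e'⟩ := List.append_inj' e rfl
      exact h2 (by simpa using e')
    · rw [List.concat_eq_append, ← List.cons_append, ← List.append_assoc] at e
      exact h1 _ _ (List.append_inj' e rfl).1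

theorem isCanonicalSeq_iff_s14 {π : List ℕ} :
    IsCanonicalSeq π ↔ 0 ∉ π ∧ ∀ c, 1 ≤ c → Preceded c π := by
  induction π using List.reverseRecOn with
  | nil => simp [IsCanonicalSeq, Preceded]
  | append_singleton π x ih =>
    rw [isCanonicalSeq_concat]
    simp only [preceded_concat, List.mem_append, List.mem_singleton, not_or]
    constructor
    · rintro ⟨h, h1, h2⟩
      obtain ⟨h3, h4⟩ := ih.1 h
      refine ⟨⟨h3, by omega⟩, fun c hc => ⟨h4 c hc, ?_⟩⟩
      rintro rfl
      exact h.mem_of_le.1 c hc (by omega)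
    · rintro ⟨⟨h1, h2⟩, h3⟩
      refine ⟨ih.2 ⟨h1, fun c hc => (h3 c hc).1⟩, by omega, ?_⟩
      obtain h | h : x ≤ 1 ∨ 1 ≤ x - 1 := by omega
      · omega
      · have := le_foldr_max ((h3 (x - 1) h).2 (by omega))
        omega

theorem IsCanonicalSeq.mem_of_lt {π : List ℕ} (h : IsCanonicalSeq π) {x c : ℕ} (hx : 1 ≤ x)
    (hc : x < c) {l₁ l₂ : List ℕ} (e : π = l₁ ++ c :: l₂) : x ∈ l₁ := by
  induction c generalizing l₁ l₂ with
  | zero => omega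
  | succ c ih =>
    have hm := (isCanonicalSeq_iff_s14.1 h).2 c (by omega) _ _ e
    obtain rfl | hxc : x = c ∨ x < c := by omega
    · exact hm
    · obtain ⟨a, a', rfl⟩ := List.append_of_mem hm
      have := ih hxc (l₁ := a) (l₂ := a' ++ (c + 1) :: l₂) (by simpa using e)
      simp [this]

theorem ContainsPat.map_compare_sublist {π σ : List ℕ} (h : ContainsPat π σ)
    (j : Fin σ.length) : ∃ c, σ.map (compare · (σ.get j)) <+ π.map (compare · c) := by
  obtain ⟨f, hf, H⟩ := h
  refine ⟨π.get (f j), List.sublist_iff_exists_fin_orderEmbedding_get_eq.2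
    ⟨OrderEmbedding.ofStrictMono (fun i => Fin.cast (by simp) (f (Fin.cast (by simp) i)))
      (fun i i' hi => hf hi), fun i => ?_⟩⟩
  have key : ∀ i, compare (σ.get i) (σ.get j) = compare (π.get (f i)) (π.get (f j)) := by
    intro i
    obtain h | h | h := lt_trichotomy (σ.get i) (σ.get j)
    · rw [compare_lt_iff_lt.2 h, compare_lt_iff_lt.2 ((H _ _).1 h)]
    · rw [compare_eq_iff_eq.2 h, eq_comm, compare_eq_iff_eq]
      have h1 := H i j
      have h2 := H j i
      omega
    · rw [compare_gt_iff_gt.2 h, compare_gt_iff_gt.2 ((H _ _).1 h)]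
  have := key (Fin.cast (by simp) i)
  simp only [List.get_eq_getElem, List.getElem_map, Fin.val_cast] at this ⊢
  exact this

theorem ContainsPat.of_map_sublist {π σ : List ℕ} (h : ℕ → ℕ)
    (hh : ∀ u ∈ σ, ∀ v ∈ σ, u < v ↔ h u < h v) (H : σ.map h <+ π) : ContainsPat π σ := by
  obtain ⟨f, hf⟩ := List.sublist_iff_exists_fin_orderEmbedding_get_eq.1 H
  refine ⟨fun i => f (Fin.cast (by simp) i), fun i j hij => f.strictMono hij, fun i j => ?_⟩
  rw [← hf, ← hf]
  simpa using hh _ (List.get_mem σ i) _ (List.get_mem σ j)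

theorem containsPat_iff_s14 {π : List ℕ} (hπ : IsCanonicalSeq π) (s q r : ℕ) :
    ContainsPat π (1 :: List.replicate (s + 1) 2 ++ 1 :: List.replicate q 2 ++
      3 :: List.replicate r 2) ↔ ∃ c, HasShapeAt c (s + 1) q r π := by
  constructor
  · intro h
    obtain ⟨c, hc⟩ := h.map_compare_sublist ⟨1, by simp⟩
    refine ⟨c, (List.sublist_cons_self .lt _).trans ?_⟩
    have h1 : compare 1 2 = Ordering.lt := rfl
    have h2 : compare 2 2 = Ordering.eq := rfl
    have h3 : compare 3 2 = Ordering.gt := rfl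
    simpa [shapePat, List.replicate_succ, h1, h2, h3] using hc
  · rintro ⟨c, hc⟩
    obtain ⟨m, hm, e⟩ := List.sublist_map_iff.1 hc
    obtain ⟨x, y, hx, hy, rfl⟩ : ∃ x y, x < c ∧ c < y ∧ m = List.replicate (s + 1) c ++
        (x :: (List.replicate q c ++ (y :: List.replicate r c))) := by
      rw [shapePat, eq_comm, List.map_eq_append_iff] at e
      obtain ⟨m₁, m₂, rfl, e1, e2⟩ := e
      obtain ⟨x, m₃, rfl, hx, e3⟩ := List.map_eq_cons_iff.1 e2
      obtain ⟨m₄, m₅, rfl, e4, e5⟩ := List.map_eq_append_iff.1 e3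
      obtain ⟨y, m₆, rfl, hy, e6⟩ := List.map_eq_cons_iff.1 e5
      have key : ∀ {n m}, List.map (compare · c) m = List.replicate n .eq →
          m = List.replicate n c := by
        intro n m h
        rw [List.eq_replicate_iff] at h ⊢
        refine ⟨by simpa using h.1, fun z hz => ?_⟩
        exact compare_eq_iff_eq.1 (h.2 _ (List.mem_map_of_mem hz))
      exact ⟨x, y, compare_lt_iff_lt.1 hx, compare_gt_iff_gt.1 hy, by
        rw [key e1, key e4, key e6]⟩
    have hx1 : 1 ≤ x := by
      rw [Nat.one_le_iff_ne_zero]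
      rintro rfl
      exact (isCanonicalSeq_iff_s14.1 hπ).1 (hm.subset (by simp))
    rw [List.replicate_succ, List.cons_append] at hm
    obtain ⟨r₁, r₂, rfl, h1, h2⟩ := List.cons_sublist_iff.1 hm
    obtain ⟨a, a', rfl⟩ := List.append_of_mem h1
    have hxa : x ∈ a := hπ.mem_of_lt hx1 hx (l₂ := a' ++ r₂) (by simp)
    refine .of_map_sublist (fun n => if n = 1 then x else if n = 2 then c else y) ?_ ?_
    · simp only [List.mem_append, List.mem_cons, List.mem_replicate]
      rintro u hu v hv
      have hu' : u = 1 ∨ u = 2 ∨ u = 3 := by tauto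
      have hv' : v = 1 ∨ v = 2 ∨ v = 3 := by tauto
      rcases hu' with rfl | rfl | rfl <;> rcases hv' with rfl | rfl | rfl <;> simp <;> omega
    · have : [x] ++ ([c] ++ _) <+ a ++ (c :: a' ++ r₂) :=
        (List.singleton_sublist.2 hxa).append
          ((List.singleton_sublist.2 (by simp)).append h2)
      simpa [List.replicate_succ] using this

theorem hasShapeAt_pos {c s q r : ℕ} {π : List ℕ} (h : HasShapeAt c (s + 1) q r π) :
    0 < c ∧ c ∈ π := by
  obtain ⟨m, hm, e⟩ := List.sublist_map_iff.1 h
  constructor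
  · have : Ordering.lt ∈ m.map (compare · c) := by simp [← e, shapePat]
    obtain ⟨x, -, hx⟩ := List.mem_map.1 this
    have := compare_lt_iff_lt.1 hx
    omega
  · have : Ordering.eq ∈ m.map (compare · c) := by simp [← e, shapePat]
    obtain ⟨x, hx, hx'⟩ := List.mem_map.1 this
    exact compare_eq_iff_eq.1 hx' ▸ hm.subset hx

/-- The words of canonical form of length `n` avoiding the first pattern at letters `≥ j` and
the second one at letters `< j`. -/
def hybrid (n p q r j : ℕ) : Set (List ℕ) :=
  {π | π.length = n ∧ IsCanonicalSeq π ∧ (∀ c < j, ¬ HasShapeAt c (p + 1) q (r + 1) π) ∧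
    ∀ c ≥ j, ¬ HasShapeAt c (p + 2) q r π}

theorem ncard_eq_of_rel {α : Type*} {S T : Set α} (R : α → α → Prop)
    (h1 : ∀ a ∈ S, ∃ b ∈ T, R a b) (h2 : ∀ b ∈ T, ∃ a ∈ S, R a b)
    (h3 : ∀ a b b', R a b → R a b' → b = b') (h4 : ∀ a a' b, R a b → R a' b → a = a') :
    S.ncard = T.ncard := by
  choose f hf hR using h1
  refine Set.ncard_congr f hf (fun a b ha hb e => h4 _ _ _ (hR a ha) (e ▸ hR b hb)) fun b hb => ?_
  obtain ⟨a, ha, hab⟩ := h2 b hb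
  exact ⟨a, ha, h3 _ _ _ (hR a ha) hab⟩

theorem Twin.canonical_iff {b : ℕ} {π π' : List ℕ} (h : Twin b π π') (hb : 0 < b) :
    IsCanonicalSeq π ↔ IsCanonicalSeq π' := by
  simp only [isCanonicalSeq_iff_s14, h.zero_mem hb, h.preceded]

theorem ncard_hybrid_succ_s14 (n p q r : ℕ) {b : ℕ} (hb : 0 < b) :
    (hybrid n p q r b).ncard = (hybrid n p q r (b + 1)).ncard := by
  have key : ∀ {π π'}, WordRel b p r π π' → ((π.length = n ∧ IsCanonicalSeq π ∧
      (∀ c < b, ¬ HasShapeAt c (p + 1) q (r + 1) π) ∧ ∀ c > b, ¬ HasShapeAt c (p + 2) q r π) ↔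
      (π'.length = n ∧ IsCanonicalSeq π' ∧ (∀ c < b, ¬ HasShapeAt c (p + 1) q (r + 1) π') ∧
        ∀ c > b, ¬ HasShapeAt c (p + 2) q r π')) := by
    intro π π' h
    obtain rfl | h := h.eq_or_twin
    · rfl
    · rw [h.length, h.canonical_iff hb]
      refine and_congr_right fun _ => and_congr_right fun _ => and_congr ?_ ?_
      · exact forall₂_congr fun c hc => not_congr (h.hasShapeAt_of_lt hc)
      · exact forall₂_congr fun c hc => not_congr (h.hasShapeAt_of_gt hc)
  refine ncard_eq_of_rel (WordRel b p r) ?_ ?_ (fun _ _ _ => WordRel.right_unique)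
    (fun _ _ _ => WordRel.left_unique)
  · rintro π ⟨h1, h2, h3, h4⟩
    obtain ⟨π', hb', hR⟩ := exists_wordRel (h4 b le_rfl)
    obtain ⟨h1', h2', h3', h4'⟩ := (key hR).1 ⟨h1, h2, h3, fun c hc => h4 c hc.le⟩
    refine ⟨π', ⟨h1', h2', fun c hc => ?_, fun c hc => h4' c hc⟩, hR⟩
    obtain hc | rfl := Nat.lt_succ_iff_lt_or_eq.1 hc
    · exact h3' c hc
    · exact hb'
  · rintro π ⟨h1, h2, h3, h4⟩
    obtain ⟨π', hb', hR⟩ := exists_wordRel' (h3 b b.lt_succ_self)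
    obtain ⟨h1', h2', h3', h4'⟩ := (key hR).2 ⟨h1, h2, fun c hc => h3 c (hc.trans b.lt_succ_self),
      fun c hc => h4 c hc⟩
    refine ⟨π', ⟨h1', h2', h3', fun c hc => ?_⟩, hR⟩
    obtain rfl | hc := Nat.eq_or_lt_of_le hc
    · exact hb'
    · exact h4' c hc

/-- For all p, q, r ≥ 0, the pattern 12^(p+2)12^q32^r is
equivalent to the pattern 12^(p+1)12^q32^(r+1). -/
theorem statement14 (p q r : ℕ) :
    PatEquiv
      (1 :: List.replicate (p + 2) 2 ++ 1 :: List.replicate q 2 ++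
         3 :: List.replicate r 2)
      (1 :: List.replicate (p + 1) 2 ++ 1 :: List.replicate q 2 ++
         3 :: List.replicate (r + 1) 2) := by
  intro n
  have h : ∀ k, (hybrid n p q r (k + 1)).ncard = (hybrid n p q r 1).ncard := by
    intro k
    induction k with
    | zero => rfl
    | succ k ih => rw [← ncard_hybrid_succ_s14 n p q r k.succ_pos, ih]
  rw [pAvoid, pAvoid]
  refine Eq.trans (congrArg _ ?_) ((h n).symm.trans (congrArg _ ?_))
  · ext π
    refine and_congr_right fun hn => and_congr_right fun hc => ?_
    rw [AvoidsPat, containsPat_iff_s14 hc, not_exists]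
    refine ⟨fun H => ⟨fun c hc h => ?_, fun c _ => H c⟩, fun H c h => ?_⟩
    · have := (hasShapeAt_pos h).1
      omega
    · exact H.2 c (hasShapeAt_pos h).1 h
  · ext π
    refine and_congr_right fun hn => and_congr_right fun hc => ?_
    rw [AvoidsPat, containsPat_iff_s14 hc, not_exists]
    have hle : ∀ x ∈ π, x < n + 1 := fun x hx =>
      Nat.lt_succ_of_le (hn ▸ (le_foldr_max hx).trans hc.mem_of_le.2)
    refine ⟨fun H c h => ?_, fun H => ⟨fun c _ => H c, fun c hc h => ?_⟩⟩
    · exact H.1 c (hle c (hasShapeAt_pos h).2) h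
    · have := hle c (hasShapeAt_pos h).2
      omega
end
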